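/- arXiv:1707.01674 — 4 statements merged into one kernel-verified Lean document; each statement's English description precedes it below -/
import Mathlib

section
/- Let μ ∈ ℍ, let n be a nonnegative integer, let α ∈ ℍ, and let β ∈ ℍ lie in a slice ℝ + ℝJ (J ∈ 𝕊) containing μ (so that β commutes with μ). Then the function f on ℍ∖ℝ defined by f(q) := qⁿ · α · ₁F₁^L(|q|² | −μ, n+1) · β satisfies (□f)(q) = f(q)·μ for every q ∈ ℍ∖ℝ. -/
open MeasureTheory Quaternion

noncomputable section

/-- quaternionic (left) Pochhammer symbol `(a)_k = a(a+1)⋯(a+k-1)` -/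
def pochQ (a : ℍ[ℝ]) (k : ℕ) : ℍ[ℝ] := ((List.range k).map fun i => a + (i : ℍ[ℝ])).prod

/-- left confluent hypergeometric function `₁F₁^L(t | -μ, c)` -/
def F1L (μ : ℍ[ℝ]) (c : ℝ) (t : ℝ) : ℍ[ℝ] :=
  ∑' k : ℕ, ((t ^ k / (Nat.factorial k * ∏ i ∈ Finset.range k, (c + i))) : ℝ) • pochQ (-μ) k

/-- the sliced operator `□` at `q = x + yI`, `x = Re q`, `y = |Im q|`, `I = Im q/|Im q|`;
the partial derivatives of the slice function `g_I(x,y) = f(x + yI)` are taken through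
the one-variable sections. -/
def Box (f : ℍ[ℝ] → ℍ[ℝ]) (q : ℍ[ℝ]) : ℍ[ℝ] :=
  let x : ℝ := q.re
  let y : ℝ := ‖q.im‖
  let I : ℍ[ℝ] := ‖q.im‖⁻¹ • q.im
  (-(1 / 4 : ℝ)) • (deriv (deriv fun u : ℝ => f ((u : ℍ[ℝ]) + y • I)) x +
      deriv (deriv fun v : ℝ => f ((x : ℍ[ℝ]) + v • I)) y) +
    (1 / 2 : ℝ) • (x • deriv (fun u : ℝ => f ((u : ℍ[ℝ]) + y • I)) x +
      y • deriv (fun v : ℝ => f ((x : ℍ[ℝ]) + v • I)) y) +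
    (1 / 2 : ℝ) • (I * (x • deriv (fun v : ℝ => f ((x : ℍ[ℝ]) + v • I)) y -
      y • deriv (fun u : ℝ => f ((u : ℍ[ℝ]) + y • I)) x))

/-- A factorial bound making `∑ t ^ k • b k` converge for every real `t`. -/
def FactorialBound {E : Type*} [NormedAddCommGroup E] (b : ℕ → E) : Prop :=
  ∃ C M : ℝ, 0 ≤ M ∧ ∀ k, ‖b k‖ ≤ C * (M ^ k / k.factorial)

/-- The coefficients of the derivative of the power series with coefficients `b`. -/
def derivCoeff {E : Type*} [NormedAddCommGroup E] [NormedSpace ℝ E] (b : ℕ → E) (k : ℕ) : E :=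
  ((k : ℝ) + 1) • b (k + 1)

section PowerSeries

variable {E : Type*} [NormedAddCommGroup E] [NormedSpace ℝ E] {b : ℕ → E}

theorem FactorialBound.derivCoeff (hb : FactorialBound b) : FactorialBound (derivCoeff b) := by
  obtain ⟨C, M, hM, h⟩ := hb
  refine ⟨C * M, M, hM, fun k => ?_⟩
  have hk : (0 : ℝ) < (k : ℝ) + 1 := by positivity
  rw [_root_.derivCoeff, norm_smul, Real.norm_of_nonneg hk.le]
  calc ((k : ℝ) + 1) * ‖b (k + 1)‖
      ≤ ((k : ℝ) + 1) * (C * (M ^ (k + 1) / (k + 1).factorial)) := by gcongr; exact h _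
    _ = C * M * (M ^ k / k.factorial) := by
      rw [Nat.factorial_succ]; push_cast; field_simp; ring

theorem FactorialBound.norm_term_le {C M : ℝ}
    (h : ∀ k, ‖b k‖ ≤ C * (M ^ k / k.factorial)) {t R : ℝ} (ht : |t| ≤ R) (k : ℕ) :
    ‖t ^ k • b k‖ ≤ C * ((R * M) ^ k / k.factorial) := by
  have hR : 0 ≤ R := (abs_nonneg t).trans ht
  rw [norm_smul, norm_pow, Real.norm_eq_abs]
  calc |t| ^ k * ‖b k‖ ≤ R ^ k * (C * (M ^ k / k.factorial)) := by gcongr; exact h k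
    _ = C * ((R * M) ^ k / k.factorial) := by rw [mul_pow]; ring

variable [CompleteSpace E]

theorem FactorialBound.summable (hb : FactorialBound b) (t : ℝ) :
    Summable fun k => t ^ k • b k := by
  obtain ⟨C, M, -, h⟩ := hb
  exact .of_norm_bounded ((Real.summable_pow_div_factorial (|t| * M)).mul_left C)
    (norm_term_le h le_rfl)

theorem FactorialBound.hasDerivAt (hb : FactorialBound b) (t : ℝ) :
    HasDerivAt (fun s : ℝ => ∑' k, s ^ k • b k) (∑' k, t ^ k • _root_.derivCoeff b k) t := by
  obtain ⟨C, M, -, h⟩ := hb.derivCoeff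
  have hmem : t ∈ Metric.ball (0 : ℝ) (|t| + 1) := by simp
  have key := hasDerivAt_tsum_of_isPreconnected
    (g := fun k (s : ℝ) => s ^ (k + 1) • b (k + 1))
    (g' := fun k (s : ℝ) => s ^ k • _root_.derivCoeff b k)
    ((Real.summable_pow_div_factorial ((|t| + 1) * M)).mul_left C)
    Metric.isOpen_ball (convex_ball (0 : ℝ) (|t| + 1)).isPreconnected
    (fun k s _ => by
      have := (hasDerivAt_pow (k + 1) s).smul_const (b (k + 1))
      convert this using 1
      rw [_root_.derivCoeff, smul_smul]
      push_cast
      simp [mul_comm])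
    (fun k s hs => norm_term_le h (by simpa using (mem_ball_zero_iff.1 hs).le) k)
    hmem ((summable_nat_add_iff 1).2 (hb.summable t)) hmem
  have hsplit : (fun s : ℝ => ∑' k, s ^ k • b k)
      = fun s => b 0 + ∑' k, s ^ (k + 1) • b (k + 1) := by
    ext s
    rw [(hb.summable s).tsum_eq_zero_add]
    simp
  rw [hsplit]
  exact key.const_add _

/-- The product of `t` with the derived power series has coefficients `k • b k`. -/
theorem FactorialBound.hasSum_smul_derivCoeff (hb : FactorialBound b) (t : ℝ) :
    HasSum (fun k : ℕ => t ^ k • ((k : ℝ) • b k)) (t • ∑' k, t ^ k • _root_.derivCoeff b k) := by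
  rw [← hasSum_nat_add_iff' 1]
  have := (hb.derivCoeff.summable t).hasSum.const_smul t
  simpa [_root_.derivCoeff, smul_smul, pow_succ', mul_assoc] using this

end PowerSeries

theorem pochQ_succ (a : ℍ[ℝ]) (k : ℕ) : pochQ a (k + 1) = pochQ a k * (a + (k : ℍ[ℝ])) := by
  simp [pochQ, List.range_succ]

/-- The Taylor coefficients of the left confluent hypergeometric function. -/
def kummerCoeff (μ : ℍ[ℝ]) (c : ℝ) (k : ℕ) : ℍ[ℝ] :=
  (Nat.factorial k * ∏ i ∈ Finset.range k, (c + i) : ℝ)⁻¹ • pochQ (-μ) k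

theorem F1L_eq_tsum (μ : ℍ[ℝ]) (c t : ℝ) : F1L μ c t = ∑' k, t ^ k • kummerCoeff μ c k := by
  simp [F1L, kummerCoeff, smul_smul, div_eq_mul_inv]

theorem kummerCoeff_succ (μ : ℍ[ℝ]) {c : ℝ} (hc : 0 < c) (k : ℕ) :
    (((k : ℝ) + 1) * (c + k)) • kummerCoeff μ c (k + 1)
      = kummerCoeff μ c k * (-μ + (k : ℍ[ℝ])) := by
  have hck : c + k ≠ 0 := by positivity
  have hk : (k : ℝ) + 1 ≠ 0 := by positivity
  rw [kummerCoeff, kummerCoeff, pochQ_succ, smul_mul_assoc, smul_smul, Finset.prod_range_succ,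
    Nat.factorial_succ]
  congr 1
  push_cast
  field_simp

theorem factorialBound_kummerCoeff (μ : ℍ[ℝ]) {c : ℝ} (hc : 0 < c) :
    FactorialBound (kummerCoeff μ c) := by
  refine ⟨1, ‖μ‖ / c + 1, by positivity, fun k => ?_⟩
  induction k with
  | zero => simp [kummerCoeff, pochQ]
  | succ k ih =>
    have hck : 0 < c + k := by positivity
    have hk : 0 < (k : ℝ) + 1 := by positivity
    have h := congrArg norm (kummerCoeff_succ μ hc k)
    rw [norm_smul, norm_mul (kummerCoeff μ c k), Real.norm_of_nonneg (mul_pos hk hck).le] at h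
    have hfac : ‖-μ + (k : ℍ[ℝ])‖ ≤ (‖μ‖ / c + 1) * (c + k) := by
      have h1 : ‖-μ + (k : ℍ[ℝ])‖ ≤ ‖μ‖ + k := by
        have := norm_add_le (-μ) (k : ℍ[ℝ])
        rwa [norm_neg, ← Quaternion.coe_natCast, Quaternion.norm_coe,
          Real.norm_of_nonneg k.cast_nonneg] at this
      have h2 : (‖μ‖ / c + 1) * (c + k) = ‖μ‖ + k + (‖μ‖ / c * k + c) := by field_simp; ring
      have h3 : 0 ≤ ‖μ‖ / c * k + c := by positivity
      linarith
    have h4 : ((k : ℝ) + 1) * (c + k) * ‖kummerCoeff μ c (k + 1)‖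
        ≤ 1 * ((‖μ‖ / c + 1) ^ k / k.factorial) * ((‖μ‖ / c + 1) * (c + k)) := by
      rw [h]; gcongr
    have h5 : 1 * ((‖μ‖ / c + 1) ^ k / k.factorial) * ((‖μ‖ / c + 1) * (c + k))
        = ((k : ℝ) + 1) * (c + k) *
          (1 * ((‖μ‖ / c + 1) ^ (k + 1) / (k + 1).factorial)) := by
      rw [Nat.factorial_succ, pow_succ]; push_cast; field_simp
    rw [h5] at h4
    exact le_of_mul_le_mul_left h4 (by positivity)

/-- The left confluent hypergeometric function is twice differentiable and solves Kummer's
equation, with the parameter acting on the right. -/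
theorem exists_hasDerivAt_F1L (μ : ℍ[ℝ]) {c : ℝ} (hc : 0 < c) :
    ∃ F' F'' : ℝ → ℍ[ℝ], (∀ t, HasDerivAt (F1L μ c) (F' t) t) ∧ (∀ t, HasDerivAt F' (F'' t) t) ∧
      ∀ t, F1L μ c t * μ = t • F' t - t • F'' t - c • F' t := by
  have hb := factorialBound_kummerCoeff μ hc
  refine ⟨fun t => ∑' k, t ^ k • derivCoeff (kummerCoeff μ c) k,
    fun t => ∑' k, t ^ k • derivCoeff (derivCoeff (kummerCoeff μ c)) k, fun t => ?_,
    hb.derivCoeff.hasDerivAt, fun t => ?_⟩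
  · rw [show F1L μ c = fun s => ∑' k, s ^ k • kummerCoeff μ c k from
      funext (F1L_eq_tsum μ c)]
    exact hb.hasDerivAt t
  · rw [F1L_eq_tsum]
    have h0 := (hb.summable t).hasSum.mul_right μ
    have h1 := ((hb.hasSum_smul_derivCoeff t).sub (hb.derivCoeff.hasSum_smul_derivCoeff t)).sub
      ((hb.derivCoeff.summable t).hasSum.const_smul c)
    refine h0.unique (h1.congr_fun fun k => ?_)
    have hrec := kummerCoeff_succ μ hc k
    have hμ : kummerCoeff μ c k * μ = (k : ℝ) • kummerCoeff μ c k
        - (((k : ℝ) + 1) * (c + k)) • kummerCoeff μ c (k + 1) := by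
      rw [hrec, mul_add, mul_neg, ← Quaternion.coe_natCast, Quaternion.mul_coe_eq_smul]
      abel
    rw [smul_mul_assoc, hμ, derivCoeff]
    module

section Slice

variable {z : ℝ → ℍ[ℝ]} {w : ℍ[ℝ]}

theorem hasDerivAt_pow_of_commute (hz : ∀ u, HasDerivAt z w u) (hc : ∀ u, Commute w (z u))
    (n : ℕ) (u : ℝ) :
    HasDerivAt (fun u => z u ^ n) ((n : ℝ) • (w * z u ^ (n - 1))) u := by
  induction n with
  | zero => simpa using hasDerivAt_const u (1 : ℍ[ℝ])
  | succ n ih =>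
    have h := ih.mul (hz u)
    simp only [pow_succ]
    refine h.congr_deriv ?_
    rcases n with _ | n
    · simp
    · have hcomm := ((hc u).pow_right (n + 1)).eq
      simp only [Nat.add_sub_cancel, smul_mul_assoc, mul_assoc, ← pow_succ, ← hcomm]
      push_cast
      module

variable {F F' F'' : ℝ → ℍ[ℝ]}

theorem hasDerivAt_comp_sq_add (hF : ∀ t, HasDerivAt F (F' t) t) (α β : ℍ[ℝ]) (d u : ℝ) :
    HasDerivAt (fun u => α * F (u ^ 2 + d) * β) ((2 * u) • (α * F' (u ^ 2 + d) * β)) u := by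
  have h1 : HasDerivAt (fun u : ℝ => u ^ 2 + d) (2 * u) u := by
    simpa using (hasDerivAt_pow 2 u).add_const d
  have h2 := (((hF (u ^ 2 + d)).scomp u h1).const_mul α).mul_const β
  refine h2.congr_deriv ?_
  simp

theorem hasDerivAt_pow_mul_comp (hz : ∀ u, HasDerivAt z w u) (hc : ∀ u, Commute w (z u))
    (hF : ∀ t, HasDerivAt F (F' t) t) (n : ℕ) (α β : ℍ[ℝ]) (d u : ℝ) :
    HasDerivAt (fun u => z u ^ n * (α * F (u ^ 2 + d) * β))
      ((n : ℝ) • (w * (z u ^ (n - 1) * (α * F (u ^ 2 + d) * β)))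
        + (2 * u) • (z u ^ n * (α * F' (u ^ 2 + d) * β))) u := by
  have h := (hasDerivAt_pow_of_commute hz hc n u).mul (hasDerivAt_comp_sq_add hF α β d u)
  refine h.congr_deriv ?_
  simp only [smul_mul_assoc, mul_smul_comm, mul_assoc]

theorem deriv_deriv_pow_mul_comp (hz : ∀ u, HasDerivAt z w u) (hc : ∀ u, Commute w (z u))
    (hF : ∀ t, HasDerivAt F (F' t) t) (hF' : ∀ t, HasDerivAt F' (F'' t) t)
    (n : ℕ) (α β : ℍ[ℝ]) (d u : ℝ) :
    deriv (deriv fun u => z u ^ n * (α * F (u ^ 2 + d) * β)) u =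
      ((n : ℝ) * (n - 1 : ℕ)) • (w * (w * (z u ^ (n - 1 - 1) * (α * F (u ^ 2 + d) * β))))
        + (4 * u * n) • (w * (z u ^ (n - 1) * (α * F' (u ^ 2 + d) * β)))
        + (2 : ℝ) • (z u ^ n * (α * F' (u ^ 2 + d) * β))
        + (4 * u ^ 2) • (z u ^ n * (α * F'' (u ^ 2 + d) * β)) := by
  rw [show deriv (fun u => z u ^ n * (α * F (u ^ 2 + d) * β)) = _ from
    funext fun u => (hasDerivAt_pow_mul_comp hz hc hF n α β d u).deriv]
  have h1 := ((hasDerivAt_pow_mul_comp hz hc hF (n - 1) α β d u).const_mul w).const_smul (n : ℝ)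
  have h2 := ((hasDerivAt_id u).const_mul 2).smul (hasDerivAt_pow_mul_comp hz hc hF' n α β d u)
  refine (h1.add h2).deriv.trans ?_
  simp only [mul_add, mul_smul_comm, id]
  module

end Slice

theorem norm_sq_coe_add_smul {I : ℍ[ℝ]} (hre : I.re = 0) (hI : ‖I‖ = 1) (u v : ℝ) :
    ‖(u : ℍ[ℝ]) + v • I‖ ^ 2 = u ^ 2 + v ^ 2 := by
  have h1 : Quaternion.normSq I = 1 := by rw [Quaternion.normSq_eq_norm_mul_self, hI, one_mul]
  rw [sq, ← Quaternion.normSq_eq_norm_mul_self]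
  rw [Quaternion.normSq_def'] at h1 ⊢
  simp [hre] at h1 ⊢
  linear_combination v ^ 2 * h1

theorem mul_self_eq_neg_one_of_re_eq_zero {I : ℍ[ℝ]} (hre : I.re = 0) (hI : ‖I‖ = 1) :
    I * I = -1 := by
  have hstar : star I = -I := by ext <;> simp [hre]
  have h := Quaternion.self_mul_star I
  rw [hstar, Quaternion.normSq_eq_norm_mul_self, hI] at h
  rw [← neg_inj, ← mul_neg, h]
  simp

/-- If `μ ∈ ℍ`, `n` is a nonnegative integer, `α ∈ ℍ` and `β` lies in a
slice `ℝ + ℝJ` containing `μ`, then `f(q) = qⁿ·α·₁F₁^L(|q|² | −μ, n+1)·β` satisfies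
`(□f)(q) = f(q)·μ` on `ℍ∖ℝ`. -/
theorem stmt2 (μ α β J : ℍ[ℝ]) (hJ : J ^ 2 = -1)
    (hμ : ∃ a b : ℝ, μ = (a : ℍ[ℝ]) + b • J)
    (hβ : ∃ c d : ℝ, β = (c : ℍ[ℝ]) + d • J)
    (n : ℕ) (q : ℍ[ℝ]) (hq : q.im ≠ 0) :
    Box (fun p => p ^ n * α * F1L μ ((n : ℝ) + 1) (‖p‖ ^ 2) * β) q =
      (q ^ n * α * F1L μ ((n : ℝ) + 1) (‖q‖ ^ 2) * β) * μ := by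
  obtain ⟨a, b, rfl⟩ := hμ
  obtain ⟨c, d, rfl⟩ := hβ
  set μ : ℍ[ℝ] := (a : ℍ[ℝ]) + b • J
  set β : ℍ[ℝ] := (c : ℍ[ℝ]) + d • J
  have hcomm : β * μ = μ * β := by
    have hJJ : Commute (d • J) (b • J) := ((Commute.refl J).smul_left d).smul_right b
    exact (((Quaternion.coe_commute c _).add_left
      ((Quaternion.coe_commute a _).symm.add_right hJJ))).eq
  obtain ⟨F', F'', hF, hF', hode⟩ :=
    exists_hasDerivAt_F1L μ (c := (n : ℝ) + 1) (by positivity)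
  have hy : ‖q.im‖ ≠ 0 := norm_ne_zero_iff.2 hq
  have hIre : (‖q.im‖⁻¹ • q.im).re = 0 := by simp
  have hInorm : ‖‖q.im‖⁻¹ • q.im‖ = 1 := by
    rw [norm_smul, norm_inv, norm_norm, inv_mul_cancel₀ hy]
  have hqI : q = (q.re : ℍ[ℝ]) + ‖q.im‖ • (‖q.im‖⁻¹ • q.im) := by
    rw [smul_smul, mul_inv_cancel₀ hy, one_smul, Quaternion.re_add_im]
  have hI := mul_self_eq_neg_one_of_re_eq_zero hIre hInorm
  unfold Box
  dsimp only
  generalize ‖q.im‖⁻¹ • q.im = I at *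
  generalize ‖q.im‖ = y at *
  generalize q.re = x at *
  subst hqI
  have hcoe (u : ℝ) : HasDerivAt (fun u : ℝ => (u : ℍ[ℝ])) 1 u := by
    have h := (hasDerivAt_id u).smul_const (1 : ℍ[ℝ])
    simpa [← Quaternion.coe_mul_eq_smul] using h
  have hzx (u : ℝ) : HasDerivAt (fun u : ℝ => (u : ℍ[ℝ]) + y • I) 1 u :=
    (hcoe u).add_const _
  have hzy (v : ℝ) : HasDerivAt (fun v : ℝ => (x : ℍ[ℝ]) + v • I) I v := by
    simpa using ((hasDerivAt_id v).smul_const I).const_add (x : ℍ[ℝ])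
  have hcx (u : ℝ) : Commute 1 ((u : ℍ[ℝ]) + y • I) := Commute.one_left _
  have hcy (v : ℝ) : Commute I ((x : ℍ[ℝ]) + v • I) :=
    (Quaternion.coe_commute x I).symm.add_right ((Commute.refl I).smul_right v)
  have hfx : (fun u : ℝ => ((u : ℍ[ℝ]) + y • I) ^ n * α
        * F1L μ ((n : ℝ) + 1) (‖(u : ℍ[ℝ]) + y • I‖ ^ 2) * β)
      = fun u : ℝ => ((u : ℍ[ℝ]) + y • I) ^ n * (α * F1L μ ((n : ℝ) + 1) (u ^ 2 + y ^ 2) * β) := by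
    funext u
    rw [norm_sq_coe_add_smul hIre hInorm]
    simp only [mul_assoc]
  have hfy : (fun v : ℝ => ((x : ℍ[ℝ]) + v • I) ^ n * α
        * F1L μ ((n : ℝ) + 1) (‖(x : ℍ[ℝ]) + v • I‖ ^ 2) * β)
      = fun v : ℝ => ((x : ℍ[ℝ]) + v • I) ^ n * (α * F1L μ ((n : ℝ) + 1) (v ^ 2 + x ^ 2) * β) := by
    funext v
    rw [norm_sq_coe_add_smul hIre hInorm, add_comm (x ^ 2)]
    simp only [mul_assoc]
  rw [hfx, hfy, (hasDerivAt_pow_mul_comp hzx hcx hF n α β (y ^ 2) x).deriv,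
    (hasDerivAt_pow_mul_comp hzy hcy hF n α β (x ^ 2) y).deriv,
    deriv_deriv_pow_mul_comp hzx hcx hF hF' n α β (y ^ 2) x,
    deriv_deriv_pow_mul_comp hzy hcy hF hF' n α β (x ^ 2) y,
    norm_sq_coe_add_smul hIre hInorm, add_comm (y ^ 2)]
  have hrhs : ((x : ℍ[ℝ]) + y • I) ^ n * α * F1L μ ((n : ℝ) + 1) (x ^ 2 + y ^ 2) * β * μ
      = ((x : ℍ[ℝ]) + y • I) ^ n * (α * (F1L μ ((n : ℝ) + 1) (x ^ 2 + y ^ 2) * μ) * β) := by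
    simp only [mul_assoc, hcomm]
  rw [hrhs, hode]
  have hpow (X : ℍ[ℝ]) : (n : ℝ) • (x • (((x : ℍ[ℝ]) + y • I) ^ (n - 1) * X)
      + y • (I * (((x : ℍ[ℝ]) + y • I) ^ (n - 1) * X)))
      = (n : ℝ) • (((x : ℍ[ℝ]) + y • I) ^ n * X) := by
    rcases n with _ | n
    · simp
    · rw [Nat.add_sub_cancel, pow_succ', mul_assoc, add_mul, Quaternion.coe_mul_eq_smul,
        smul_mul_assoc]
  have hII (X : ℍ[ℝ]) : I * (I * X) = -X := by rw [← mul_assoc, hI, neg_one_mul]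
  have hB := hpow (α * F' (x ^ 2 + y ^ 2) * β)
  simp only [mul_add, mul_sub, sub_mul, mul_smul_comm, smul_mul_assoc, one_mul, hII] at hB ⊢
  linear_combination (norm := module) (-1 : ℝ) • hB
end
end

section
/- Let μ ∈ ℍ be a quaternion which is not a nonnegative integer. Then for every nonnegative integer n, the function t ↦ tⁿ·|₁F₁^L(t | −μ, n+1)|²·e^{−t} is not Lebesgue-integrable on (0,∞), i.e. ∫_0^∞ tⁿ·|₁F₁^L(t | −μ, n+1)|²·e^{−t} dt = +∞. -/
open MeasureTheory Quaternion

noncomputable section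

open Filter Topology

/-- The coefficients `(-μ)_k / k!` of the binomial series `(1 - x)^μ`. -/
def binomCoeffQ (μ : ℍ[ℝ]) (k : ℕ) : ℍ[ℝ] := ((Nat.factorial k : ℝ)⁻¹) • pochQ (-μ) k

/-- The binomial series `(1 - x)^μ = ∑ x^k (-μ)_k / k!`. -/
def binomSeriesQ (μ : ℍ[ℝ]) (x : ℝ) : ℍ[ℝ] := ∑' k : ℕ, x ^ k • binomCoeffQ μ k

lemma binomCoeffQ_zero (μ : ℍ[ℝ]) : binomCoeffQ μ 0 = 1 := by
  simp [binomCoeffQ, pochQ]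

lemma binomCoeffQ_succ (μ : ℍ[ℝ]) (k : ℕ) :
    ((k : ℝ) + 1) • binomCoeffQ μ (k + 1) = (k : ℝ) • binomCoeffQ μ k - binomCoeffQ μ k * μ := by
  have h1 : pochQ (-μ) (k + 1) = pochQ (-μ) k * (-μ + (k : ℍ[ℝ])) := by
    simp [pochQ, List.range_succ]
  have h2 : ((k : ℝ) + 1) * ((k + 1).factorial : ℝ)⁻¹ = ((k.factorial : ℝ))⁻¹ := by
    have := Nat.factorial_ne_zero k
    rw [Nat.factorial_succ]
    push_cast
    field_simp
  have h3 : pochQ (-μ) k * (k : ℍ[ℝ]) = (k : ℝ) • pochQ (-μ) k := by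
    rw [← Nat.cast_comm, ← nsmul_eq_mul, Nat.cast_smul_eq_nsmul]
  rw [binomCoeffQ, smul_smul, h2, h1, binomCoeffQ, smul_mul_assoc, smul_comm, ← h3, ← smul_sub,
    mul_add, mul_neg]
  congr 1
  abel

lemma norm_binomCoeffQ_le (μ : ℍ[ℝ]) {M : ℕ} (hM : ‖μ‖ ≤ M) (k : ℕ) :
    ‖binomCoeffQ μ k‖ ≤ ((k + M).choose M : ℝ) := by
  induction k with
  | zero => simp [binomCoeffQ_zero]
  | succ k ih =>
    have hc : (((k + 1 + M).choose M : ℕ) : ℝ) * (k + 1) = ((k + M).choose M : ℝ) * (k + M + 1) := by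
      have h := Nat.choose_mul_succ_eq (k + M) M
      rw [show k + M + 1 - M = k + 1 by omega, show k + M + 1 = k + 1 + M by ring] at h
      have h' := congrArg (Nat.cast (R := ℝ)) h
      push_cast at h'
      linarith
    have hn : ((k : ℝ) + 1) * ‖binomCoeffQ μ (k + 1)‖ ≤ (k + M) * ‖binomCoeffQ μ k‖ := by
      have : ((k : ℝ) + 1) * ‖binomCoeffQ μ (k + 1)‖ = ‖((k : ℝ) + 1) • binomCoeffQ μ (k + 1)‖ := by
        rw [norm_smul, Real.norm_of_nonneg (by positivity)]
      rw [this, binomCoeffQ_succ]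
      refine (norm_sub_le _ _).trans ?_
      rw [norm_smul, norm_mul, Real.norm_of_nonneg (by positivity)]
      nlinarith [norm_nonneg (binomCoeffQ μ k)]
    have hk : (0 : ℝ) < k + 1 := by positivity
    refine le_of_mul_le_mul_left ?_ hk
    have : (0 : ℝ) ≤ ((k + M).choose M : ℝ) := by positivity
    have hM0 : (0 : ℝ) ≤ k + M := by positivity
    nlinarith [mul_le_mul_of_nonneg_left ih hM0]

lemma summable_pow_mul_norm_binomCoeffQ (μ : ℍ[ℝ]) {r : ℝ} (hr0 : 0 ≤ r) (hr : r < 1) :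
    Summable fun k : ℕ => r ^ k * ‖binomCoeffQ μ k‖ := by
  obtain ⟨M, hM⟩ := exists_nat_ge ‖μ‖
  refine .of_nonneg_of_le (fun k => by positivity) (fun k => ?_)
    (summable_choose_mul_geometric_of_norm_lt_one M (r := r) (by rwa [Real.norm_of_nonneg hr0]))
  rw [mul_comm]
  gcongr
  exact norm_binomCoeffQ_le μ hM k

lemma summable_deriv_binomSeriesQ (μ : ℍ[ℝ]) {r : ℝ} (hr0 : 0 ≤ r) (hr : r < 1) :
    Summable fun k : ℕ => (k * r ^ (k - 1)) * ‖binomCoeffQ μ k‖ := by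
  obtain ⟨M, hM⟩ := exists_nat_ge ‖μ‖
  rw [← summable_nat_add_iff 1]
  refine .of_nonneg_of_le (fun k => by positivity) (fun k => ?_)
    ((summable_choose_mul_geometric_of_norm_lt_one (M + 1) (r := r)
      (by rwa [Real.norm_of_nonneg hr0])).mul_left ((M : ℝ) + 1))
  have hc : (((k + (M + 1)).choose (M + 1) : ℕ) : ℝ) * (M + 1)
      = ((k + 1 + M).choose M : ℝ) * (k + 1) := by
    have h := Nat.choose_succ_right_eq (k + (M + 1)) M
    rw [show k + (M + 1) - M = k + 1 by omega] at h
    rw [show k + 1 + M = k + (M + 1) by ring]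
    exact_mod_cast h
  have h := norm_binomCoeffQ_le μ hM (k + 1)
  have hrk : 0 ≤ r ^ k * ((k : ℝ) + 1) := by positivity
  rw [add_tsub_cancel_right]
  push_cast
  nlinarith [mul_le_mul_of_nonneg_left h hrk]

lemma hasSum_binomSeriesQ (μ : ℍ[ℝ]) {x : ℝ} (hx : |x| < 1) :
    HasSum (fun k : ℕ => x ^ k • binomCoeffQ μ k) (binomSeriesQ μ x) := by
  refine Summable.hasSum (.of_norm_bounded
    (summable_pow_mul_norm_binomCoeffQ μ (abs_nonneg x) hx) fun k => ?_)
  simp [norm_smul]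

lemma exists_hasDerivAt_binomSeriesQ (μ : ℍ[ℝ]) {x : ℝ} (hx : |x| < 1) :
    ∃ D, HasDerivAt (binomSeriesQ μ) D x ∧ (1 - x) • D = -(binomSeriesQ μ x * μ) := by
  obtain ⟨r, hxr, hr⟩ := exists_between hx
  have hr0 : 0 ≤ r := (abs_nonneg x).trans hxr.le
  have hbound : ∀ (k : ℕ) (y : ℝ), |y| ≤ r →
      ‖((k : ℝ) * y ^ (k - 1)) • binomCoeffQ μ k‖ ≤ (k * r ^ (k - 1)) * ‖binomCoeffQ μ k‖ := by
    intro k y hy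
    rw [norm_smul, norm_mul, norm_pow, Real.norm_eq_abs, Real.norm_eq_abs, Nat.abs_cast]
    gcongr
  have hsum := summable_deriv_binomSeriesQ μ hr0 hr
  have hD : HasDerivAt (binomSeriesQ μ) (∑' k : ℕ, ((k : ℝ) * x ^ (k - 1)) • binomCoeffQ μ k) x := by
    refine hasDerivAt_tsum_of_isPreconnected (t := Metric.ball 0 r) (y₀ := x) hsum
      Metric.isOpen_ball (convex_ball 0 r).isPreconnected
      (fun k y _ => (hasDerivAt_pow k y).smul_const _)
      (fun k y hy => hbound k y (by simpa using (mem_ball_zero_iff.mp hy).le))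
      (by simpa using hxr) (hasSum_binomSeriesQ μ hx).summable (by simpa using hxr)
  refine ⟨_, hD, ?_⟩
  set D := ∑' k : ℕ, ((k : ℝ) * x ^ (k - 1)) • binomCoeffQ μ k
  have hDsum : HasSum (fun k : ℕ => ((k : ℝ) * x ^ (k - 1)) • binomCoeffQ μ k) D :=
    (Summable.of_norm_bounded hsum fun k => hbound k x hxr.le).hasSum
  have hshift : HasSum (fun k : ℕ => (((k : ℝ) + 1) * x ^ k) • binomCoeffQ μ (k + 1)) D := by
    have := (hasSum_nat_add_iff' 1).mpr hDsum
    simpa using this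
  have hrec := (hDsum.const_smul x).sub ((hasSum_binomSeriesQ μ hx).mul_right μ)
  have heq : D = x • D - binomSeriesQ μ x * μ := by
    refine hshift.unique (hrec.congr_fun ?_)
    intro k
    have hxk : x * ((k : ℝ) * x ^ (k - 1)) = x ^ k * k := by
      rcases k with _ | k
      · simp
      · simp [pow_succ]; ring
    rw [mul_comm, mul_smul, binomCoeffQ_succ, smul_sub, smul_smul, smul_smul, hxk, smul_mul_assoc]
  rw [sub_smul, one_smul]
  nth_rewrite 1 [heq]
  abel

lemma analyticOnNhd_binomSeriesQ (μ : ℍ[ℝ]) :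
    AnalyticOnNhd ℝ (binomSeriesQ μ) (Metric.ball 0 1) := by
  let p : FormalMultilinearSeries ℝ ℝ ℍ[ℝ] :=
    fun k => ContinuousMultilinearMap.mkPiRing ℝ (Fin k) (binomCoeffQ μ k)
  have hp : 1 ≤ p.radius := by
    refine ENNReal.le_of_forall_nnreal_lt fun r hr => p.le_radius_of_summable_norm ?_
    simpa [p, mul_comm] using
      summable_pow_mul_norm_binomCoeffQ μ r.2 (by exact_mod_cast hr : (r : ℝ) < 1)
  have hps : p.sum = binomSeriesQ μ := by
    ext1 x
    simp [p, FormalMultilinearSeries.sum, binomSeriesQ]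
  intro x hx
  have := p.hasFPowerSeriesOnBall (zero_lt_one.trans_le hp)
  rw [hps] at this
  refine this.analyticAt_of_mem ?_
  refine Metric.eball_subset_eball hp ?_
  simpa [edist_dist] using hx

/-- An analytic solution of `(1 - x) Q' = -Q μ` to the left of `1` is locally zero, unless `μ` is
a natural number. -/
lemma eventually_eq_zero_or_eq_natCast {μ : ℍ[ℝ]} {Q : ℝ → ℍ[ℝ]} (hQ : AnalyticAt ℝ Q 1)
    (hode : ∀ᶠ x in 𝓝[<] (1 : ℝ), (1 - x) • deriv Q x = -(Q x * μ)) :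
    (∀ᶠ x in 𝓝 1, Q x = 0) ∨ ∃ m : ℕ, μ = (m : ℍ[ℝ]) := by
  by_contra! hcon
  obtain ⟨hne, hμ⟩ := hcon
  obtain ⟨m, g, hg, hg1, hQg⟩ := hQ.exists_eventuallyEq_pow_smul_nonzero_iff.mpr (by simpa using hne)
  refine hμ m ?_
  have hder : ∀ᶠ x in 𝓝[<] (1 : ℝ), (m : ℝ) • g x + (x - 1) • deriv g x = g x * μ := by
    have h1 := hQg.eventually_nhds.filter_mono (nhdsWithin_le_nhds (s := Set.Iio 1))
    have h2 := hg.eventually_analyticAt.filter_mono (nhdsWithin_le_nhds (s := Set.Iio 1))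
    filter_upwards [hode, h1, h2, self_mem_nhdsWithin] with x hx hQx hgx hlt
    have hx1 : x - 1 ≠ 0 := sub_ne_zero.mpr (ne_of_lt hlt)
    have hd : HasDerivAt (fun z : ℝ => (z - 1) ^ m • g z)
        ((x - 1) ^ m • deriv g x + (m * (x - 1) ^ (m - 1) * 1) • g x) x :=
      (((hasDerivAt_id x).sub_const 1).pow m).smul hgx.differentiableAt.hasDerivAt
    have hQx : Q =ᶠ[𝓝 x] fun z => (z - 1) ^ m • g z := hQx
    rw [hQx.deriv_eq, hd.deriv, hQx.eq_of_nhds] at hx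
    have hm : (x - 1) * (m * (x - 1) ^ (m - 1)) = (x - 1) ^ m * m := by
      rcases m with _ | m
      · simp
      · simp [pow_succ]; ring
    have hx' : (x - 1) ^ m • ((m : ℝ) • g x + (x - 1) • deriv g x) = (x - 1) ^ m • (g x * μ) := by
      rw [← smul_mul_assoc, ← neg_inj, ← hx, mul_one, ← neg_sub x 1, neg_smul, neg_inj, smul_add,
        smul_add, smul_smul, smul_smul, smul_smul, smul_smul, hm, mul_comm (x - 1), add_comm]
    exact smul_right_injective _ (pow_ne_zero m hx1) hx'
  have hlim1 : Tendsto (fun x => (m : ℝ) • g x + (x - 1) • deriv g x) (𝓝[<] 1)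
      (𝓝 ((m : ℝ) • g 1 + ((1 : ℝ) - 1) • deriv g 1)) := by
    refine Tendsto.mono_left ?_ nhdsWithin_le_nhds
    have hcg := hg.continuousAt
    have hcd := hg.deriv.continuousAt
    exact Tendsto.add (hcg.tendsto.const_smul _)
      (Tendsto.smul (tendsto_id.sub_const 1) hcd.tendsto)
  have hlim2 : Tendsto (fun x => g x * μ) (𝓝[<] 1) (𝓝 (g 1 * μ)) :=
    (hg.continuousAt.mul continuousAt_const).tendsto.mono_left nhdsWithin_le_nhds
  have h := tendsto_nhds_unique (hlim1.congr' hder) hlim2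
  rw [sub_self, zero_smul, add_zero, Nat.cast_smul_eq_nsmul, nsmul_eq_mul, Nat.cast_comm] at h
  exact (mul_left_cancel₀ hg1 h).symm

lemma integrableOn_pow_mul_exp_neg (m : ℕ) {s : ℝ} (hs : 0 < s) :
    IntegrableOn (fun t : ℝ => t ^ m * Real.exp (-s * t)) (Set.Ioi 0) := by
  have h := integrableOn_rpow_mul_exp_neg_mul_rpow (p := 1) (s := m) (b := s)
    (by have : (0 : ℝ) ≤ m := by positivity
        linarith) one_pos hs
  simpa using h

lemma integral_pow_mul_exp_neg (m : ℕ) {s : ℝ} (hs : 0 < s) :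
    ∫ t in Set.Ioi (0 : ℝ), t ^ m * Real.exp (-s * t) = (m.factorial : ℝ) * s⁻¹ ^ (m + 1) := by
  have h := Real.integral_rpow_mul_exp_neg_mul_Ioi (a := (m : ℝ) + 1) (by positivity) hs
  rw [Real.Gamma_nat_eq_factorial] at h
  simp only [add_sub_cancel_right, Real.rpow_natCast, ← neg_mul] at h
  rw [h, mul_comm, one_div]
  congr 1
  exact_mod_cast Real.rpow_natCast s⁻¹ (m + 1)

lemma F1L_term_eq (μ : ℍ[ℝ]) (n k : ℕ) (t : ℝ) :
    ((t ^ k / (Nat.factorial k * ∏ i ∈ Finset.range k, (((n : ℝ) + 1) + i))) : ℝ) • pochQ (-μ) k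
      = (n.factorial / (n + k).factorial * t ^ k : ℝ) • binomCoeffQ μ k := by
  have hprod : (n.factorial : ℝ) * ∏ i ∈ Finset.range k, (((n : ℝ) + 1) + i)
      = (n + k).factorial := by
    induction k with
    | zero => simp
    | succ k ih =>
      rw [Finset.prod_range_succ, ← mul_assoc, ih, ← add_assoc, Nat.factorial_succ]
      push_cast
      ring
  have hn : (n.factorial : ℝ) ≠ 0 := by positivity
  have hp : ∏ i ∈ Finset.range k, (((n : ℝ) + 1) + i) ≠ 0 :=
    Finset.prod_ne_zero_iff.mpr fun i _ => by positivity
  rw [binomCoeffQ, smul_smul, ← hprod]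
  congr 1
  field_simp

lemma hasSum_F1L (μ : ℍ[ℝ]) (n : ℕ) (t : ℝ) :
    HasSum (fun k : ℕ => (n.factorial / (n + k).factorial * t ^ k : ℝ) • binomCoeffQ μ k)
      (F1L μ ((n : ℝ) + 1) t) := by
  have hF : F1L μ ((n : ℝ) + 1) t
      = ∑' k : ℕ, (n.factorial / (n + k).factorial * t ^ k : ℝ) • binomCoeffQ μ k :=
    tsum_congr fun k => F1L_term_eq μ n k t
  rw [hF]
  refine Summable.hasSum ?_
  obtain ⟨M, hM⟩ := exists_nat_ge ‖μ‖
  refine .of_norm_bounded ((Real.summable_pow_div_factorial (2 * |t|)).mul_left (2 ^ M)) fun k => ?_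
  have hfac : (n.factorial / (n + k).factorial : ℝ) ≤ (k.factorial : ℝ)⁻¹ := by
    rw [div_le_iff₀ (by positivity), ← div_eq_inv_mul, le_div_iff₀ (by positivity)]
    exact_mod_cast Nat.le_of_dvd (Nat.factorial_pos _)
      (Nat.factorial_mul_factorial_dvd_factorial_add n k)
  have hchoose : ((k + M).choose M : ℝ) ≤ 2 ^ (k + M) := by
    exact_mod_cast Nat.choose_le_two_pow _ _
  have hb := (norm_binomCoeffQ_le μ hM k).trans hchoose
  rw [norm_smul, norm_mul, norm_pow, Real.norm_eq_abs t, Real.norm_of_nonneg (by positivity)]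
  calc (n.factorial / (n + k).factorial : ℝ) * |t| ^ k * ‖binomCoeffQ μ k‖
      ≤ (k.factorial : ℝ)⁻¹ * |t| ^ k * 2 ^ (k + M) := by gcongr
    _ = 2 ^ M * ((2 * |t|) ^ k / k.factorial) := by rw [mul_pow, pow_add]; field_simp

lemma stronglyMeasurable_F1L (μ : ℍ[ℝ]) (n : ℕ) :
    StronglyMeasurable (F1L μ ((n : ℝ) + 1)) := by
  refine stronglyMeasurable_of_tendsto atTop
    (f := fun N t => ∑ k ∈ Finset.range N,
      (n.factorial / (n + k).factorial * t ^ k : ℝ) • binomCoeffQ μ k) (fun N => ?_) ?_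
  · exact Continuous.stronglyMeasurable (by fun_prop)
  · exact tendsto_pi_nhds.mpr fun t => (hasSum_F1L μ n t).tendsto_sum_nat

/-- The Laplace transform of `tⁿ ₁F₁^L(t | -μ, n+1)`. -/
def laplaceF1L (μ : ℍ[ℝ]) (n : ℕ) (s : ℝ) : ℍ[ℝ] :=
  ∫ t in Set.Ioi (0 : ℝ), (t ^ n * Real.exp (-s * t)) • F1L μ ((n : ℝ) + 1) t

lemma laplaceF1L_eq (μ : ℍ[ℝ]) (n : ℕ) {s : ℝ} (hs : 1 < s) :
    laplaceF1L μ n s = (n.factorial * s⁻¹ ^ (n + 1)) • binomSeriesQ μ s⁻¹ := by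
  have hs0 : 0 < s := one_pos.trans hs
  have hinv : |s⁻¹| < 1 := by rw [abs_of_pos (by positivity)]; exact inv_lt_one_of_one_lt₀ hs
  obtain ⟨f, hf⟩ : ∃ f : ℕ → ℝ → ℍ[ℝ], f = fun k t =>
      (n.factorial / (n + k).factorial * (t ^ (n + k) * Real.exp (-s * t)) : ℝ) • binomCoeffQ μ k :=
    ⟨_, rfl⟩
  have hcoef : ∀ k : ℕ, (n.factorial / (n + k).factorial : ℝ) *
      ((n + k).factorial * s⁻¹ ^ (n + k + 1)) = n.factorial * s⁻¹ ^ (n + 1) * s⁻¹ ^ k := by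
    intro k
    have : ((n + k).factorial : ℝ) ≠ 0 := by positivity
    rw [← mul_assoc, div_mul_cancel₀ _ this]
    ring
  have hint : ∀ k, IntegrableOn (f k) (Set.Ioi 0) := fun k => by
    rw [hf]
    exact ((integrableOn_pow_mul_exp_neg (n + k) hs0).const_mul _).smul_const _
  have hval : ∀ k, ∫ t in Set.Ioi (0 : ℝ), f k t
      = (n.factorial * s⁻¹ ^ (n + 1) * s⁻¹ ^ k : ℝ) • binomCoeffQ μ k := by
    intro k
    simp only [hf]
    rw [integral_smul_const, integral_const_mul, integral_pow_mul_exp_neg _ hs0, hcoef]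
  have hnorm : ∀ k, ∫ t in Set.Ioi (0 : ℝ), ‖f k t‖
      = n.factorial * s⁻¹ ^ (n + 1) * (s⁻¹ ^ k * ‖binomCoeffQ μ k‖) := by
    intro k
    rw [← mul_assoc, ← hcoef, ← integral_pow_mul_exp_neg _ hs0, ← integral_const_mul,
      ← integral_mul_const]
    refine setIntegral_congr_fun measurableSet_Ioi fun t ht => ?_
    have ht : 0 < t := ht
    simp only [hf]
    rw [norm_smul, Real.norm_of_nonneg (by positivity)]
  have hsum : Summable fun k => ∫ t in Set.Ioi (0 : ℝ), ‖f k t‖ := by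
    simp_rw [hnorm]
    exact (summable_pow_mul_norm_binomCoeffQ μ (by positivity)
      (inv_lt_one_of_one_lt₀ hs)).mul_left _
  have hS := hasSum_integral_of_summable_integral_norm hint hsum
  have hpt : ∀ t, ∑' k, f k t = (t ^ n * Real.exp (-s * t)) • F1L μ ((n : ℝ) + 1) t := by
    intro t
    have hF := (hasSum_F1L μ n t).const_smul (t ^ n * Real.exp (-s * t))
    rw [← hF.tsum_eq]
    refine tsum_congr fun k => ?_
    simp only [hf, smul_smul]
    congr 1
    ring
  have hP := (hasSum_binomSeriesQ μ hinv).const_smul (n.factorial * s⁻¹ ^ (n + 1) : ℝ)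
  simp_rw [hval, hpt] at hS
  simp_rw [smul_smul] at hP
  exact hS.unique hP

/-- By the Cauchy-Schwarz inequality, square integrability with weight `tⁿ e^{-t}` gives
integrability with weight `tⁿ e^{-3t/4}`. -/
lemma integrableOn_exp_mul_norm_F1L {μ : ℍ[ℝ]} {n : ℕ}
    (h : ∫⁻ t in Set.Ioi (0 : ℝ),
      ENNReal.ofReal (t ^ n * ‖F1L μ ((n : ℝ) + 1) t‖ ^ 2 * Real.exp (-t)) ≠ ⊤) :
    IntegrableOn (fun t => t ^ n * Real.exp (-(3 / 4) * t) * ‖F1L μ ((n : ℝ) + 1) t‖)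
      (Set.Ioi 0) := by
  have hm := (stronglyMeasurable_F1L μ n).norm
  have hsq : IntegrableOn (fun t => t ^ n * ‖F1L μ ((n : ℝ) + 1) t‖ ^ 2 * Real.exp (-t))
      (Set.Ioi 0) := by
    refine (lintegral_ofReal_ne_top_iff_integrable ?_ ?_).mp h
    · exact (((continuous_pow n).stronglyMeasurable.mul (hm.pow 2)).mul
        (Real.continuous_exp.comp continuous_neg).stronglyMeasurable).aestronglyMeasurable
    · filter_upwards [ae_restrict_mem measurableSet_Ioi] with t ht
      have ht : 0 < t := ht
      positivity
  refine (hsq.add (integrableOn_pow_mul_exp_neg n (s := 1 / 2) (by norm_num))).mono' ?_ ?_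
  · exact ((Continuous.stronglyMeasurable (by fun_prop)).mul hm).aestronglyMeasurable
  · filter_upwards [ae_restrict_mem measurableSet_Ioi] with t ht
    have ht : 0 < t := ht
    rw [Real.norm_of_nonneg (by positivity)]
    have e1 : Real.exp (-t) = Real.exp (-(1 / 2) * t) ^ 2 := by
      rw [← Real.exp_nat_mul]; ring_nf
    have e2 : Real.exp (-(1 / 2) * t) = Real.exp (-(1 / 4) * t) ^ 2 := by
      rw [← Real.exp_nat_mul]; ring_nf
    have e3 : Real.exp (-(3 / 4) * t) = Real.exp (-(1 / 2) * t) * Real.exp (-(1 / 4) * t) := by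
      rw [← Real.exp_add]; ring_nf
    set N := ‖F1L μ ((n : ℝ) + 1) t‖
    simp only [Pi.add_apply]
    rw [e1, e3]
    set A := Real.exp (-(1 / 2) * t)
    set B := Real.exp (-(1 / 4) * t)
    rw [show t ^ n * (A * B) * N = t ^ n * ((A * N) * B) by ring,
      show t ^ n * N ^ 2 * A ^ 2 + t ^ n * A = t ^ n * ((A * N) ^ 2 + A) by ring]
    gcongr
    rw [e2]
    nlinarith [sq_nonneg (A * N - B), sq_nonneg (A * N), sq_nonneg B]

lemma analyticAt_laplaceF1L {μ : ℍ[ℝ]} {n : ℕ}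
    (h : IntegrableOn (fun t => t ^ n * Real.exp (-(3 / 4) * t) * ‖F1L μ ((n : ℝ) + 1) t‖)
      (Set.Ioi 0)) :
    AnalyticAt ℝ (laplaceF1L μ n) 1 := by
  let F := F1L μ ((n : ℝ) + 1)
  have hm : StronglyMeasurable F := stronglyMeasurable_F1L μ n
  let c : ℕ → ℍ[ℝ] := fun j =>
    ∫ t in Set.Ioi (0 : ℝ), ((-t) ^ j / j.factorial * (t ^ n * Real.exp (-t))) • F t
  let p : FormalMultilinearSeries ℝ ℝ ℍ[ℝ] :=
    fun j => ContinuousMultilinearMap.mkPiRing ℝ (Fin j) (c j)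
  have hpc : ∀ j, p.coeff j = c j := fun j => by simp [p, FormalMultilinearSeries.coeff]
  refine ⟨p, hasFPowerSeriesAt_iff.mpr ?_⟩
  filter_upwards [Metric.ball_mem_nhds (0 : ℝ) (by norm_num : (0 : ℝ) < 1 / 4)] with z hz
  have hz : |z| < 1 / 4 := by simpa using hz
  simp_rw [hpc, c, ← integral_smul]
  have hexp : ∀ y : ℝ, HasSum (fun j : ℕ => y ^ j / j.factorial) (Real.exp y) := fun y => by
    rw [Real.exp_eq_exp_ℝ]
    exact NormedSpace.expSeries_div_hasSum_exp y
  have hbsum : ∀ t, HasSum (fun j : ℕ => (|z| * t) ^ j / j.factorial *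
      (t ^ n * Real.exp (-t) * ‖F t‖)) (Real.exp (|z| * t) * (t ^ n * Real.exp (-t) * ‖F t‖)) :=
    fun t => (hexp _).mul_right _
  refine hasSum_integral_of_dominated_convergence
    (fun j t => (|z| * t) ^ j / j.factorial * (t ^ n * Real.exp (-t) * ‖F t‖)) ?_ ?_ ?_ ?_ ?_
  · intro j
    have h1 : Continuous fun t : ℝ => (-t) ^ j / j.factorial * (t ^ n * Real.exp (-t)) := by
      fun_prop
    exact ((h1.stronglyMeasurable.smul hm).const_smul (z ^ j)).aestronglyMeasurable
  · intro j
    filter_upwards [ae_restrict_mem measurableSet_Ioi] with t ht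
    have ht : 0 < t := ht
    rw [norm_smul, norm_smul, norm_mul, norm_div, norm_pow, norm_pow, norm_neg,
      Real.norm_of_nonneg ht.le, Real.norm_eq_abs z, Real.norm_of_nonneg (Nat.cast_nonneg _),
      Real.norm_of_nonneg (by positivity : 0 ≤ t ^ n * Real.exp (-t)), mul_pow]
    apply le_of_eq
    ring
  · exact .of_forall fun t => (hbsum t).summable
  · simp_rw [fun t => (hbsum t).tsum_eq]
    refine Integrable.mono' h ?_ ?_
    · have h1 : Continuous fun t : ℝ => Real.exp (|z| * t) := by fun_prop
      have h2 : Continuous fun t : ℝ => t ^ n * Real.exp (-t) := by fun_prop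
      exact (h1.stronglyMeasurable.mul
        (h2.stronglyMeasurable.mul hm.norm)).aestronglyMeasurable
    · filter_upwards [ae_restrict_mem measurableSet_Ioi] with t ht
      have ht : 0 < t := ht
      rw [Real.norm_of_nonneg (by positivity), ← mul_assoc, mul_left_comm, ← Real.exp_add]
      gcongr
      nlinarith
  · refine .of_forall fun t => ?_
    have hs := ((hexp (-t * z)).mul_right (t ^ n * Real.exp (-t))).smul_const (F t)
    have hlim : Real.exp (-t * z) * (t ^ n * Real.exp (-t)) = t ^ n * Real.exp (-(1 + z) * t) := by
      rw [mul_left_comm, ← Real.exp_add]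
      ring_nf
    rw [hlim] at hs
    refine hs.congr_fun fun j => ?_
    rw [smul_smul, mul_pow]
    congr 1
    ring

/-- If `μ ∈ ℍ` is not a nonnegative integer, then for every nonnegative
integer `n`, `∫_0^∞ tⁿ·|₁F₁^L(t | −μ, n+1)|²·e^{−t} dt = +∞`. -/
theorem stmt4 (μ : ℍ[ℝ]) (hμ : ¬∃ m : ℕ, μ = (m : ℍ[ℝ])) (n : ℕ) :
    ∫⁻ t in Set.Ioi (0 : ℝ),
      ENNReal.ofReal (t ^ n * ‖F1L μ ((n : ℝ) + 1) t‖ ^ 2 * Real.exp (-t)) = ⊤ := by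
  by_contra hfin
  have hG := analyticAt_laplaceF1L (integrableOn_exp_mul_norm_F1L hfin)
  let Q : ℝ → ℍ[ℝ] := fun x => ((n.factorial * x ^ (n + 1))⁻¹ : ℝ) • laplaceF1L μ n x⁻¹
  have hQ : AnalyticAt ℝ Q 1 := by
    have hinv : AnalyticAt ℝ (fun x : ℝ => x⁻¹) 1 := analyticAt_id.inv one_ne_zero
    have hc : AnalyticAt ℝ (fun x : ℝ => (n.factorial * x ^ (n + 1) : ℝ)⁻¹) 1 :=
      (analyticAt_const.mul (analyticAt_id.pow _)).inv (by simp [Nat.factorial_ne_zero])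
    exact hc.smul (AnalyticAt.fun_comp (by simpa using hG) hinv)
  have hQP : ∀ x ∈ Set.Ioo (0 : ℝ) 1, Q x = binomSeriesQ μ x := by
    intro x hx
    have hx0 := hx.1
    simp only [Q]
    rw [laplaceF1L_eq μ n ((one_lt_inv₀ hx.1).mpr hx.2), inv_inv, inv_smul_smul₀ (by positivity)]
  have habs : ∀ x ∈ Set.Ioo (0 : ℝ) 1, |x| < 1 := fun x hx => by rw [abs_of_pos hx.1]; exact hx.2
  have hmem : Set.Ioo (0 : ℝ) 1 ∈ 𝓝[<] (1 : ℝ) := Ioo_mem_nhdsLT one_pos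
  have hode : ∀ᶠ x in 𝓝[<] (1 : ℝ), (1 - x) • deriv Q x = -(Q x * μ) := by
    filter_upwards [hmem] with x hx
    obtain ⟨D, hD, hDeq⟩ := exists_hasDerivAt_binomSeriesQ μ (habs x hx)
    have hloc : Q =ᶠ[𝓝 x] binomSeriesQ μ := eventually_of_mem (Ioo_mem_nhds hx.1 hx.2) hQP
    rw [hloc.deriv_eq, hD.deriv, hDeq, hQP x hx]
  rcases eventually_eq_zero_or_eq_natCast hQ hode with hzero | hnat
  · obtain ⟨y, hy, hy01⟩ :=
      ((hzero.eventually_nhds.filter_mono nhdsWithin_le_nhds).and hmem).exists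
    have hPy : binomSeriesQ μ =ᶠ[𝓝 y] 0 := by
      filter_upwards [hy, Ioo_mem_nhds hy01.1 hy01.2] with x hx hx01
      rw [← hQP x hx01, hx, Pi.zero_apply]
    have h0 := (analyticOnNhd_binomSeriesQ μ).eqOn_zero_of_preconnected_of_eventuallyEq_zero
      (convex_ball (0 : ℝ) 1).isPreconnected (by simpa using habs y hy01) hPy
      (Metric.mem_ball_self one_pos)
    have h1 : binomSeriesQ μ 0 = 1 := by
      rw [binomSeriesQ, tsum_eq_single 0 (fun k hk => by simp [hk])]
      simp [binomCoeffQ_zero]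
    simp [h1] at h0
  · exact hμ hnat
end
end

section
/- (a) For all nonnegative integers m, n, k, l with (n,m) ≠ (k,l): ∫_{ℍ∖ℝ} conj(H_{n,m}(q,q̄))·H_{k,l}(q,q̄)·e^{−|q|²} dλ(q) = 0, where conj denotes quaternionic conjugation. (b) For every I ∈ 𝕊 and all nonnegative integers n, m: ∫_{ℝ²} |H_{n,m}(x+Iy, x−Iy)|²·e^{−(x²+y²)} dx dy = π·n!·m!. -/
open MeasureTheory Quaternion

noncomputable section

instance : MeasurableSpace ℍ[ℝ] := borel _
instance : BorelSpace ℍ[ℝ] := ⟨rfl⟩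

/-- the surface measure `dσ` of the 2-sphere `𝕊 = {q : q² = -1}` of imaginary units,
realized as the 2-dimensional Hausdorff measure restricted to `𝕊`. -/
def sigmaS : Measure ℍ[ℝ] :=
  (MeasureTheory.Measure.hausdorffMeasure 2).restrict {q : ℍ[ℝ] | q ^ 2 = -1}

/-- the sliced measure `dλ` on `ℍ∖ℝ`: pushforward of `r dr dθ dσ(I)` on
`(0,∞)×(0,2π)×𝕊` under `(r,θ,I) ↦ r(cos θ + I sin θ)`. -/
def slicedMeasure : Measure ℍ[ℝ] :=
  Measure.map
    (fun p : ℝ × ℝ × ℍ[ℝ] =>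
      ((p.1 * Real.cos p.2.1 : ℝ) : ℍ[ℝ]) + (p.1 * Real.sin p.2.1) • p.2.2)
    ((((volume : Measure ℝ).restrict (Set.Ioi 0)).withDensity
        (fun r => ENNReal.ofReal r)).prod
      ((((volume : Measure ℝ)).restrict (Set.Ioo 0 (2 * Real.pi))).prod sigmaS))

/-- two-argument quaternionic Hermite polynomial `H_{m,n}(a,b)` -/
def qHermite2 (m n : ℕ) (a b : ℍ[ℝ]) : ℍ[ℝ] :=
  ∑ j ∈ Finset.range (min m n + 1),
    (((-1 : ℝ) ^ j * (Nat.factorial m * Nat.factorial n) /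
        (Nat.factorial j * (Nat.factorial (m - j) * Nat.factorial (n - j)))) : ℝ) •
      (a ^ (m - j) * b ^ (n - j))

/-- quaternionic Hermite polynomial `H_{m,n}(q, q̄)` -/
def qHermite (m n : ℕ) (q : ℍ[ℝ]) : ℍ[ℝ] := qHermite2 m n q (star q)


/-- The complex Hermite polynomial `H_{m,n}(x, y)` in two commuting variables. -/
def cHermite (m n : ℕ) (x y : ℂ) : ℂ :=
  ∑ j ∈ Finset.range (min m n + 1),
    ((-1 : ℝ) ^ j * j.factorial * m.choose j * n.choose j) • (x ^ (m - j) * y ^ (n - j))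

lemma cHermite_comm (m n : ℕ) (x y : ℂ) : cHermite m n x y = cHermite n m y x := by
  unfold cHermite
  rw [min_comm]
  refine Finset.sum_congr rfl fun j _ => ?_
  rw [mul_comm (x ^ _)]
  congr 1
  ring

lemma cHermite_eq_sum_range (m n : ℕ) (x y : ℂ) :
    cHermite m n x y = ∑ j ∈ Finset.range (m + 1),
      ((-1 : ℝ) ^ j * j.factorial * m.choose j * n.choose j) • (x ^ (m - j) * y ^ (n - j)) := by
  unfold cHermite
  refine Finset.sum_subset (fun j hj => ?_) fun j hj hj' => ?_
  · simp only [Finset.mem_range] at *; omega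
  · have : n < j := by simp only [Finset.mem_range] at *; omega
    simp [Nat.choose_eq_zero_of_lt this]

lemma cHermite_zero_left (n : ℕ) (x y : ℂ) : cHermite 0 n x y = y ^ n := by
  simp [cHermite]

lemma cHermite_zero_right (m : ℕ) (x y : ℂ) : cHermite m 0 x y = x ^ m := by
  simp [cHermite]

lemma cHermite_succ_succ (m n : ℕ) (x y : ℂ) :
    cHermite (m + 1) (n + 1) x y =
      x * cHermite m (n + 1) x y - (n + 1) * cHermite m n x y := by
  rw [cHermite_eq_sum_range (m + 1), cHermite_eq_sum_range m n,
    Finset.sum_range_succ' _ (m + 1)]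
  have hx : x * cHermite m (n + 1) x y = ∑ j ∈ Finset.range (m + 1),
      ((-1 : ℝ) ^ (j + 1) * (j + 1).factorial * m.choose (j + 1) * (n + 1).choose (j + 1)) •
        (x ^ (m - j) * y ^ (n - j)) + x ^ (m + 1) * y ^ (n + 1) := by
    rw [cHermite_eq_sum_range, Finset.sum_range_succ', Finset.sum_range_succ, mul_add,
      Finset.mul_sum]
    simp only [Nat.choose_succ_self]
    congr 1
    · simp only [Nat.cast_zero, mul_zero, zero_mul, zero_smul, add_zero]
      refine Finset.sum_congr rfl fun j hj => ?_
      have : m - j = m - (j + 1) + 1 := by simp only [Finset.mem_range] at hj; omega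
      rw [this, pow_succ, Nat.add_sub_add_right]
      simp only [Complex.real_smul]
      ring
    · simp; ring
  rw [hx, Finset.mul_sum, add_sub_right_comm, ← Finset.sum_sub_distrib]
  congr 1
  · refine Finset.sum_congr rfl fun j _ => ?_
    rw [Nat.add_sub_add_right, Nat.add_sub_add_right, Nat.choose_succ_succ m j]
    have h : ((n : ℂ) + 1) * n.choose j = (n + 1).choose (j + 1) * (j + 1) := by
      exact_mod_cast Nat.add_one_mul_choose_eq n j
    simp only [Complex.real_smul, Nat.factorial_succ]
    push_cast
    linear_combination (-1 : ℂ) ^ j * j.factorial * m.choose j * (x ^ (m - j) * y ^ (n - j)) * h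
  · simp

lemma descFactorial_mul_factorial_recursion {m n a b : ℕ} (h : m + 1 + a = n + 1 + b) :
    ((b.descFactorial m * ((a + 1).descFactorial (n + 1) * (a + 1 - (n + 1)).factorial) : ℕ) : ℂ)
      - (n + 1) * (b.descFactorial m * (a.descFactorial n * (a - n).factorial) : ℕ) =
    (b.descFactorial (m + 1) * (a.descFactorial (n + 1) * (a - (n + 1)).factorial) : ℕ) := by
  rw [Nat.succ_descFactorial_succ, Nat.descFactorial_succ, Nat.descFactorial_succ,
    Nat.add_sub_add_right]
  rcases lt_trichotomy a n with han | rfl | han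
  · simp [Nat.descFactorial_eq_zero_iff_lt.2 han]
  · simp
    ring
  · obtain ⟨d, rfl⟩ := Nat.exists_eq_add_of_lt han
    have hb : b - m = d + 1 := by omega
    have h₁ : n + d + 1 - n = d + 1 := by omega
    have h₂ : n + d + 1 - (n + 1) = d := by omega
    rw [hb, h₁, h₂, Nat.factorial_succ]
    push_cast
    ring

section Moments

variable {X : Type*} [MeasurableSpace X] {μ : Measure X} {x y g : X → ℂ} {c : ℂ}

/-- The functions `x, y` with weight `g` have the mixed moments of a complex Gaussian variable and
its conjugate, up to the total mass `c`. -/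
def HasGaussianMoments (μ : Measure X) (x y g : X → ℂ) (c : ℂ) : Prop :=
  ∀ p q : ℕ, Integrable (fun t => x t ^ p * y t ^ q * g t) μ ∧
    ∫ t, x t ^ p * y t ^ q * g t ∂μ = if p = q then c * p.factorial else 0

lemma HasGaussianMoments.cHermite_mul_monomial (h : HasGaussianMoments μ x y g c) (m : ℕ) :
    ∀ n a b : ℕ,
      Integrable (fun t => cHermite m n (x t) (y t) * (x t ^ a * y t ^ b * g t)) μ ∧
      ∫ t, cHermite m n (x t) (y t) * (x t ^ a * y t ^ b * g t) ∂μ =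
        if m + a = n + b then
          c * (b.descFactorial m * (a.descFactorial n * (a - n).factorial) : ℕ) else 0 := by
  induction m with
  | zero =>
    intro n a b
    have e : (fun t => cHermite 0 n (x t) (y t) * (x t ^ a * y t ^ b * g t)) =
        fun t => x t ^ a * y t ^ (n + b) * g t := by
      ext t; rw [cHermite_zero_left]; ring
    rw [e]
    refine ⟨(h _ _).1, (h _ _).2.trans ?_⟩
    rw [zero_add]
    refine if_ctx_congr Iff.rfl (fun hab => ?_) fun _ => rfl
    rw [Nat.descFactorial_zero, one_mul, mul_comm (a.descFactorial n),
      Nat.factorial_mul_descFactorial (by omega)]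
  | succ m ih =>
    intro n a b
    cases n with
    | zero =>
      have e : (fun t => cHermite (m + 1) 0 (x t) (y t) * (x t ^ a * y t ^ b * g t)) =
          fun t => x t ^ (m + 1 + a) * y t ^ b * g t := by
        ext t; rw [cHermite_zero_right]; ring
      rw [e]
      refine ⟨(h _ _).1, (h _ _).2.trans ?_⟩
      rw [zero_add]
      refine if_ctx_congr Iff.rfl (fun hab => ?_) fun _ => rfl
      have ha : a = b - (m + 1) := by omega
      rw [Nat.descFactorial_zero, one_mul, mul_comm (b.descFactorial _), Nat.sub_zero, ha,
        Nat.factorial_mul_descFactorial (by omega), Nat.add_sub_cancel' (by omega)]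
    | succ n =>
      have e : (fun t => cHermite (m + 1) (n + 1) (x t) (y t) * (x t ^ a * y t ^ b * g t)) =
          fun t => cHermite m (n + 1) (x t) (y t) * (x t ^ (a + 1) * y t ^ b * g t) -
            (n + 1) * (cHermite m n (x t) (y t) * (x t ^ a * y t ^ b * g t)) := by
        ext t; rw [cHermite_succ_succ]; ring
      obtain ⟨i₁, v₁⟩ := ih (n + 1) (a + 1) b
      obtain ⟨i₂, v₂⟩ := ih n a b
      rw [e]
      refine ⟨i₁.sub (i₂.const_mul _), ?_⟩
      rw [integral_sub i₁ (i₂.const_mul _), integral_const_mul, v₁, v₂]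
      by_cases hab : m + 1 + a = n + 1 + b
      · rw [if_pos hab, if_pos (by omega), if_pos (by omega),
          ← descFactorial_mul_factorial_recursion hab]
        ring
      · rw [if_neg hab, if_neg (by omega), if_neg (by omega)]
        simp

lemma HasGaussianMoments.cHermite_mul_cHermite_eq_sum (h : HasGaussianMoments μ x y g c)
    (m n k l : ℕ) :
    Integrable (fun t => cHermite m n (x t) (y t) * cHermite k l (x t) (y t) * g t) μ ∧
    ∫ t, cHermite m n (x t) (y t) * cHermite k l (x t) (y t) * g t ∂μ =
      ∑ j ∈ Finset.range (min k l + 1),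
        ((-1 : ℝ) ^ j * j.factorial * k.choose j * l.choose j) •
        (if m + (k - j) = n + (l - j) then c * ((l - j).descFactorial m *
          ((k - j).descFactorial n * (k - j - n).factorial) : ℕ) else 0) := by
  have e : (fun t => cHermite m n (x t) (y t) * cHermite k l (x t) (y t) * g t) =
      fun t => ∑ j ∈ Finset.range (min k l + 1),
        ((-1 : ℝ) ^ j * j.factorial * k.choose j * l.choose j) •
        (cHermite m n (x t) (y t) * (x t ^ (k - j) * y t ^ (l - j) * g t)) := by
    ext t
    rw [cHermite.eq_def k l, Finset.mul_sum, Finset.sum_mul]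
    refine Finset.sum_congr rfl fun j _ => ?_
    simp only [Complex.real_smul]
    ring
  have hi (j : ℕ) (r : ℝ) : Integrable (fun t =>
      r • (cHermite m n (x t) (y t) * (x t ^ (k - j) * y t ^ (l - j) * g t))) μ :=
    (h.cHermite_mul_monomial m n (k - j) (l - j)).1.smul r
  rw [e]
  refine ⟨integrable_finsetSum _ fun j _ => hi j _, ?_⟩
  rw [integral_finsetSum _ fun j _ => hi j _]
  refine Finset.sum_congr rfl fun j _ => ?_
  rw [integral_smul, (h.cHermite_mul_monomial m n (k - j) (l - j)).2]

lemma HasGaussianMoments.integral_cHermite_mul_cHermite_eq_zero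
    (h : HasGaussianMoments μ x y g c) {m n k l : ℕ} (hne : k < n ∨ l < m ∨ m + k ≠ n + l) :
    ∫ t, cHermite m n (x t) (y t) * cHermite k l (x t) (y t) * g t ∂μ = 0 := by
  rw [(h.cHermite_mul_cHermite_eq_sum m n k l).2]
  refine Finset.sum_eq_zero fun j hj => ?_
  rw [Finset.mem_range] at hj
  rcases hne with hkn | hlm | hmk
  · simp [Nat.descFactorial_eq_zero_iff_lt.2 (show k - j < n by omega)]
  · simp [Nat.descFactorial_eq_zero_iff_lt.2 (show l - j < m by omega)]
  · rw [if_neg (by omega), smul_zero]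

lemma HasGaussianMoments.integral_cHermite_mul_cHermite (h : HasGaussianMoments μ x y g c)
    (m n k l : ℕ) :
    ∫ t, cHermite m n (x t) (y t) * cHermite k l (x t) (y t) * g t ∂μ =
      if (n, m) = (k, l) then c * (n.factorial * m.factorial) else 0 := by
  split_ifs with hkl
  · obtain ⟨rfl, rfl⟩ := Prod.mk.inj hkl
    rw [(h.cHermite_mul_cHermite_eq_sum m n n m).2, Finset.sum_range_succ',
      Finset.sum_eq_zero fun j hj => ?_]
    · simp [Nat.descFactorial_self, add_comm, mul_comm]
    · rw [Finset.mem_range] at hj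
      simp [Nat.descFactorial_eq_zero_iff_lt.2 (show n - (j + 1) < n by omega)]
  · by_cases hne : k < n ∨ l < m ∨ m + k ≠ n + l
    · exact h.integral_cHermite_mul_cHermite_eq_zero hne
    · simp_rw [mul_comm (cHermite m n _ _)]
      refine h.integral_cHermite_mul_cHermite_eq_zero ?_
      rw [Prod.mk.injEq] at hkl
      omega

end Moments

/-- The measure `r dr` on the half line `(0, ∞)`. -/
def radialMeasure : Measure ℝ :=
  ((volume : Measure ℝ).restrict (Set.Ioi 0)).withDensity (fun r => ENNReal.ofReal r)

instance : SFinite radialMeasure := by unfold radialMeasure; infer_instance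

lemma integral_radialMeasure {E : Type*} [NormedAddCommGroup E] [NormedSpace ℝ E] (f : ℝ → E) :
    ∫ r, f r ∂radialMeasure = ∫ r in Set.Ioi 0, r • f r := by
  rw [radialMeasure, integral_withDensity_eq_integral_toReal_smul ENNReal.measurable_ofReal
    (ae_of_all _ fun _ => ENNReal.ofReal_lt_top)]
  refine setIntegral_congr_fun measurableSet_Ioi fun r hr => ?_
  simp only [ENNReal.toReal_ofReal (le_of_lt hr)]

lemma integrable_radialMeasure (k : ℕ) :
    Integrable (fun r : ℝ => ((r ^ k * Real.exp (-r ^ 2) : ℝ) : ℂ)) radialMeasure := by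
  suffices h : Integrable (fun r : ℝ => r ^ k * Real.exp (-r ^ 2)) radialMeasure from h.ofReal
  rw [radialMeasure, integrable_withDensity_iff_integrable_smul' ENNReal.measurable_ofReal
    (ae_of_all _ fun _ => ENNReal.ofReal_lt_top)]
  have h := integrableOn_rpow_mul_exp_neg_rpow (p := 2) (s := (k + 1 : ℕ))
    (by have := Nat.cast_nonneg (α := ℝ) (k + 1); linarith) two_pos
  refine IntegrableOn.congr_fun h (fun r hr => ?_) measurableSet_Ioi
  simp only [ENNReal.toReal_ofReal (le_of_lt hr), Real.rpow_natCast, Real.rpow_ofNat, smul_eq_mul]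
  ring

lemma integral_radialMeasure_even (p : ℕ) :
    ∫ r, ((r ^ (p + p) * Real.exp (-r ^ 2) : ℝ) : ℂ) ∂radialMeasure = p.factorial / 2 := by
  rw [integral_complex_ofReal, integral_radialMeasure]
  have h := integral_rpow_mul_exp_neg_rpow (p := 2) (q := (2 * p + 1 : ℕ)) two_pos
    (by have := Nat.cast_nonneg (α := ℝ) (2 * p + 1); linarith)
  have e : (((2 * p + 1 : ℕ) : ℝ) + 1) / 2 = p + 1 := by push_cast; ring
  rw [e, Real.Gamma_nat_eq_factorial] at h
  rw [setIntegral_congr_fun measurableSet_Ioi (g := fun r : ℝ =>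
    r ^ ((2 * p + 1 : ℕ) : ℝ) * Real.exp (-r ^ (2 : ℝ))), h]
  · push_cast; ring
  · intro r _
    simp only [Real.rpow_natCast, Real.rpow_ofNat, smul_eq_mul]
    ring

lemma integral_angular {a b : ℝ} (hab : b = a + 2 * Real.pi) (p q : ℕ) :
    ∫ θ in Set.Ioo a b, Complex.exp (((p : ℂ) - q) * Complex.I * θ) =
      if p = q then 2 * (Real.pi : ℂ) else 0 := by
  have hle : a ≤ b := by linarith [Real.pi_pos]
  rw [← integral_Ioc_eq_integral_Ioo, ← intervalIntegral.integral_of_le hle]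
  split_ifs with hpq
  · simp [hpq, hab]
  · have hc : ((p : ℂ) - q) * Complex.I ≠ 0 :=
      mul_ne_zero (sub_ne_zero.2 (by exact_mod_cast hpq)) Complex.I_ne_zero
    rw [integral_exp_mul_complex hc, div_eq_zero_iff, sub_eq_zero]
    left
    refine Complex.exp_eq_exp_iff_exists_int.2 ⟨(p : ℤ) - q, ?_⟩
    rw [hab]
    push_cast
    ring

/-- The complex number with polar coordinates `(r, θ)`. -/
def polarPoint (t : ℝ × ℝ) : ℂ := ⟨t.1 * Real.cos t.2, t.1 * Real.sin t.2⟩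

lemma polarPoint_eq (t : ℝ × ℝ) : polarPoint t = t.1 * Complex.exp (t.2 * Complex.I) := by
  apply Complex.ext <;> simp [polarPoint, Complex.exp_ofReal_mul_I_re, Complex.exp_ofReal_mul_I_im]

lemma norm_polarPoint_sq (t : ℝ × ℝ) : ‖polarPoint t‖ ^ 2 = t.1 ^ 2 := by
  rw [polarPoint_eq, norm_mul, Complex.norm_exp_ofReal_mul_I, mul_one, Complex.norm_real,
    Real.norm_eq_abs, sq_abs]

lemma hasGaussianMoments_polar {a b : ℝ} (hab : b = a + 2 * Real.pi) :
    HasGaussianMoments (radialMeasure.prod (volume.restrict (Set.Ioo a b))) polarPoint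
      (fun t => star (polarPoint t)) (fun t => (Real.exp (-‖polarPoint t‖ ^ 2) : ℂ)) Real.pi := by
  intro p q
  have e : (fun t : ℝ × ℝ => polarPoint t ^ p * star (polarPoint t) ^ q *
      (Real.exp (-‖polarPoint t‖ ^ 2) : ℂ)) =
      fun t => ((t.1 ^ (p + q) * Real.exp (-t.1 ^ 2) : ℝ) : ℂ) *
        Complex.exp (((p : ℂ) - q) * Complex.I * t.2) := by
    ext t
    have h : star (polarPoint t) = t.1 * Complex.exp (-(t.2 * Complex.I)) := by
      rw [polarPoint_eq, Complex.star_def, map_mul, ← Complex.exp_conj]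
      simp
    have h' : Complex.exp (((p : ℂ) - q) * Complex.I * t.2) =
        Complex.exp (t.2 * Complex.I) ^ p * Complex.exp (-(t.2 * Complex.I)) ^ q := by
      rw [← Complex.exp_nat_mul, ← Complex.exp_nat_mul, ← Complex.exp_add]
      congr 1
      ring
    rw [norm_polarPoint_sq, h, h', polarPoint_eq]
    push_cast
    ring
  rw [e]
  constructor
  · refine (integrable_radialMeasure _).mul_prod (g := fun θ : ℝ =>
      Complex.exp (((p : ℂ) - q) * Complex.I * θ)) ?_
    exact ((by fun_prop : Continuous fun θ : ℝ =>
      Complex.exp (((p : ℂ) - q) * Complex.I * θ)).integrableOn_Icc).mono_set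
        Set.Ioo_subset_Icc_self
  · rw [integral_prod_mul (μ := radialMeasure)
      (fun r : ℝ => ((r ^ (p + q) * Real.exp (-r ^ 2) : ℝ) : ℂ))
      (fun θ : ℝ => Complex.exp (((p : ℂ) - q) * Complex.I * θ)), integral_angular hab]
    split_ifs with hpq
    · subst hpq
      rw [integral_radialMeasure_even]
      ring
    · rw [mul_zero]

lemma star_cHermite (m n : ℕ) (z : ℂ) :
    star (cHermite n m z (star z)) = cHermite m n z (star z) := by
  rw [cHermite_comm m n]
  simp [cHermite]

lemma integrable_star_cHermite_mul_cHermite {a b : ℝ} (hab : b = a + 2 * Real.pi)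
    (n m k l : ℕ) :
    Integrable (fun t => Real.exp (-‖polarPoint t‖ ^ 2) •
      (star (cHermite n m (polarPoint t) (star (polarPoint t))) *
        cHermite k l (polarPoint t) (star (polarPoint t))))
      (radialMeasure.prod (volume.restrict (Set.Ioo a b))) := by
  simp_rw [star_cHermite, Complex.real_smul, mul_comm (Complex.ofReal _)]
  exact ((hasGaussianMoments_polar hab).cHermite_mul_cHermite_eq_sum m n k l).1

lemma integral_star_cHermite_mul_cHermite {a b : ℝ} (hab : b = a + 2 * Real.pi)
    (n m k l : ℕ) :
    ∫ t, Real.exp (-‖polarPoint t‖ ^ 2) •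
      (star (cHermite n m (polarPoint t) (star (polarPoint t))) *
        cHermite k l (polarPoint t) (star (polarPoint t)))
      ∂(radialMeasure.prod (volume.restrict (Set.Ioo a b))) =
      if (n, m) = (k, l) then (Real.pi : ℂ) * (n.factorial * m.factorial) else 0 := by
  simp_rw [star_cHermite, Complex.real_smul, mul_comm (Complex.ofReal (Real.exp _))]
  exact (hasGaussianMoments_polar hab).integral_cHermite_mul_cHermite m n k l

section Slice

variable {I : ℍ[ℝ]}

lemma re_eq_zero_and_sum_sq_of_sq_eq_neg_one (hI : I ^ 2 = -1) : I.re = 0 ∧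
    I.imI ^ 2 + I.imJ ^ 2 + I.imK ^ 2 = 1 := by
  rw [sq] at hI
  have h₀ := congrArg QuaternionAlgebra.re hI
  have h₁ := congrArg QuaternionAlgebra.imI hI
  have h₂ := congrArg QuaternionAlgebra.imJ hI
  have h₃ := congrArg QuaternionAlgebra.imK hI
  simp at h₀ h₁ h₂ h₃
  have hre : I.re = 0 := by
    by_contra hne
    have e₁ : I.imI = 0 := mul_left_cancel₀ hne (by linarith)
    have e₂ : I.imJ = 0 := mul_left_cancel₀ hne (by linarith)
    have e₃ : I.imK = 0 := mul_left_cancel₀ hne (by linarith)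
    rw [e₁, e₂, e₃] at h₀
    nlinarith [sq_nonneg I.re]
  refine ⟨hre, ?_⟩
  rw [hre] at h₀
  linarith

/-- The embedding of `ℂ` into the quaternions as the slice `ℝ + ℝ I`. -/
def sliceHom (hI : I ^ 2 = -1) : ℂ →ₐ[ℝ] ℍ[ℝ] := Complex.liftAux I (by rw [← sq, hI])

lemma sliceHom_apply (hI : I ^ 2 = -1) (z : ℂ) :
    sliceHom hI z = (z.re : ℍ[ℝ]) + z.im • I :=
  Complex.liftAux_apply I _ z

lemma star_sliceHom (hI : I ^ 2 = -1) (z : ℂ) :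
    star (sliceHom hI z) = sliceHom hI (star z) := by
  have hs : star I = -I := by
    ext <;> simp [(re_eq_zero_and_sum_sq_of_sq_eq_neg_one hI).1]
  simp [sliceHom_apply, hs]

lemma norm_sliceHom_sq (hI : I ^ 2 = -1) (z : ℂ) : ‖sliceHom hI z‖ ^ 2 = ‖z‖ ^ 2 := by
  rw [sq, ← Quaternion.normSq_eq_norm_mul_self, ← Complex.normSq_eq_norm_sq]
  apply Quaternion.coe_injective
  rw [← Quaternion.self_mul_star, star_sliceHom, ← map_mul, Complex.star_def, Complex.mul_conj,
    sliceHom_apply]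
  simp

lemma qHermite2_sliceHom (hI : I ^ 2 = -1) (m n : ℕ) (x y : ℂ) :
    qHermite2 m n (sliceHom hI x) (sliceHom hI y) = sliceHom hI (cHermite m n x y) := by
  rw [qHermite2, cHermite, map_sum]
  refine Finset.sum_congr rfl fun j hj => ?_
  rw [Finset.mem_range] at hj
  rw [map_smul, map_mul, map_pow, map_pow]
  congr 1
  rw [Nat.cast_choose ℝ (show j ≤ m by omega), Nat.cast_choose ℝ (show j ≤ n by omega)]
  field_simp

lemma weighted_qHermite_sliceHom (hI : I ^ 2 = -1) (n m k l : ℕ) (z : ℂ) :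
    Real.exp (-‖sliceHom hI z‖ ^ 2) •
      (star (qHermite n m (sliceHom hI z)) * qHermite k l (sliceHom hI z)) =
    sliceHom hI (Real.exp (-‖z‖ ^ 2) •
      (star (cHermite n m z (star z)) * cHermite k l z (star z))) := by
  rw [qHermite, qHermite, star_sliceHom, qHermite2_sliceHom, qHermite2_sliceHom, star_sliceHom,
    norm_sliceHom_sq, map_smul, map_mul]

end Slice

/-- The spherical coordinate parametrization of the sphere of imaginary units. -/
def sphericalPoint (v : Fin 2 → ℝ) : ℍ[ℝ] :=
  (Real.sin (v 0) * Real.cos (v 1)) • (⟨0, 1, 0, 0⟩ : ℍ[ℝ]) +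
    (Real.sin (v 0) * Real.sin (v 1)) • (⟨0, 0, 1, 0⟩ : ℍ[ℝ]) +
      Real.cos (v 0) • (⟨0, 0, 0, 1⟩ : ℍ[ℝ])

lemma contDiff_sphericalPoint : ContDiff ℝ 1 sphericalPoint := by
  unfold sphericalPoint
  fun_prop

lemma imaginaryUnits_subset_image_sphericalPoint :
    {q : ℍ[ℝ] | q ^ 2 = -1} ⊆ sphericalPoint '' Metric.closedBall 0 Real.pi := by
  intro q hq
  obtain ⟨hre, hsum⟩ := re_eq_zero_and_sum_sq_of_sq_eq_neg_one hq
  set w : ℂ := ⟨q.imI, q.imJ⟩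
  have hw : ‖w‖ = Real.sin (Real.arccos q.imK) := by
    rw [Real.sin_arccos, Complex.norm_def, Complex.normSq_apply]
    congr 1
    simp only [w]
    linarith
  have hK : |q.imK| ≤ 1 := by
    rw [← sq_le_one_iff_abs_le_one]
    nlinarith [sq_nonneg q.imI, sq_nonneg q.imJ]
  refine ⟨![Real.arccos q.imK, w.arg], ?_, ?_⟩
  · rw [mem_closedBall_zero_iff, pi_norm_le_iff_of_nonneg Real.pi_pos.le]
    intro i
    fin_cases i
    · simpa [abs_of_nonneg (Real.arccos_nonneg _)] using Real.arccos_le_pi q.imK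
    · simpa using Complex.abs_arg_le_pi w
  · have h₁ : Real.sin (Real.arccos q.imK) * Real.cos w.arg = q.imI := by
      rw [← hw, Complex.norm_mul_cos_arg]
    have h₂ : Real.sin (Real.arccos q.imK) * Real.sin w.arg = q.imJ := by
      rw [← hw, Complex.norm_mul_sin_arg]
    have h₃ : Real.cos (Real.arccos q.imK) = q.imK :=
      Real.cos_arccos (abs_le.1 hK).1 (abs_le.1 hK).2
    simp only [sphericalPoint, Matrix.cons_val_zero, Matrix.cons_val_one, h₁, h₂, h₃]
    ext <;> simp [hre]

instance : IsFiniteMeasure sigmaS := by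
  refine ⟨?_⟩
  rw [sigmaS, Measure.restrict_apply_univ]
  obtain ⟨K, hK⟩ := (contDiff_sphericalPoint.locallyLipschitz.locallyLipschitzOn
    (s := Metric.closedBall 0 Real.pi)).exists_lipschitzOnWith_of_compact
      (isCompact_closedBall _ _)
  refine (measure_mono imaginaryUnits_subset_image_sphericalPoint).trans_lt
    ((hK.hausdorffMeasure_image_le zero_le_two).trans_lt ?_)
  have hvol : (Measure.hausdorffMeasure 2 : Measure (Fin 2 → ℝ)) = volume := by
    simpa using hausdorffMeasure_pi_real (ι := Fin 2)
  rw [hvol]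
  exact ENNReal.mul_lt_top (by simp) (isCompact_closedBall _ _).measure_lt_top

lemma ae_sigmaS_sq_eq_neg_one : ∀ᵐ I ∂sigmaS, I ^ 2 = -1 :=
  ae_restrict_mem (isClosed_eq (continuous_pow 2) continuous_const).measurableSet

lemma continuous_qHermite (m n : ℕ) : Continuous (qHermite m n) := by
  unfold qHermite qHermite2
  fun_prop

/-- A function whose integral over almost every slice vanishes has vanishing integral with respect
to the sliced measure. -/
lemma integral_slicedMeasure_eq_zero {F : ℍ[ℝ] → ℍ[ℝ]} (hF : Continuous F)
    (h : ∀ I (hI : I ^ 2 = -1), ∫ t, F (sliceHom hI (polarPoint t))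
      ∂(radialMeasure.prod (volume.restrict (Set.Ioo 0 (2 * Real.pi)))) = 0) :
    ∫ q, F q ∂slicedMeasure = 0 := by
  have hcont : Continuous fun p : ℝ × ℝ × ℍ[ℝ] =>
      ((p.1 * Real.cos p.2.1 : ℝ) : ℍ[ℝ]) + (p.1 * Real.sin p.2.1) • p.2.2 := by
    refine Continuous.add (Quaternion.continuous_coe.comp ?_) ?_ <;> fun_prop
  rw [slicedMeasure, integral_map hcont.measurable.aemeasurable hF.aestronglyMeasurable]
  change ∫ p, _ ∂radialMeasure.prod _ = 0
  rw [← (⟨MeasurableEquiv.prodAssoc.measurable, Measure.prodAssoc_prod⟩ :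
    MeasurePreserving (MeasurableEquiv.prodAssoc (α := ℝ) (β := ℝ) (γ := ℍ[ℝ]))
      ((radialMeasure.prod (volume.restrict (Set.Ioo 0 (2 * Real.pi)))).prod sigmaS)
      _).integral_comp']
  by_cases hint : Integrable (fun p : (ℝ × ℝ) × ℍ[ℝ] =>
      F (((p.1.1 * Real.cos p.1.2 : ℝ) : ℍ[ℝ]) + (p.1.1 * Real.sin p.1.2) • p.2))
      ((radialMeasure.prod (volume.restrict (Set.Ioo 0 (2 * Real.pi)))).prod sigmaS)
  · refine (integral_prod_symm _ hint).trans (integral_eq_zero_of_ae ?_)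
    filter_upwards [ae_sigmaS_sq_eq_neg_one] with I hI
    simpa only [sliceHom_apply, polarPoint, Pi.zero_apply] using h I hI
  · exact integral_undef hint

lemma integral_eq_integral_polar (f : ℝ × ℝ → ℝ) :
    ∫ p, f p = ∫ t, f ((polarPoint t).re, (polarPoint t).im)
      ∂(radialMeasure.prod (volume.restrict (Set.Ioo (-Real.pi) Real.pi))) := by
  rw [radialMeasure, prod_withDensity_left ENNReal.measurable_ofReal, Measure.prod_restrict,
    integral_withDensity_eq_integral_toReal_smul (by fun_prop)
      (ae_of_all _ fun _ => ENNReal.ofReal_lt_top), ← integral_comp_polarCoord_symm]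
  refine setIntegral_congr_fun (measurableSet_Ioi.prod measurableSet_Ioo) fun t ht => ?_
  simp only [ENNReal.toReal_ofReal (le_of_lt ht.1), polarCoord_symm_apply, polarPoint]

/-- (a) The quaternionic Hermite polynomials are pairwise orthogonal in
`L²(ℍ∖ℝ; e^{−|q|²} dλ)`; (b) on every slice, `∫ |H_{n,m}|² e^{−(x²+y²)} dx dy = π·n!·m!`. -/
theorem stmt9 :
    (∀ n m k l : ℕ, (n, m) ≠ (k, l) →
      ∫ q : ℍ[ℝ],
          Real.exp (-‖q‖ ^ 2) • (star (qHermite n m q) * qHermite k l q)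
        ∂slicedMeasure = 0) ∧
    (∀ I : ℍ[ℝ], I ^ 2 = -1 → ∀ n m : ℕ,
      ∫ p : ℝ × ℝ,
          ‖qHermite2 n m ((p.1 : ℍ[ℝ]) + p.2 • I) ((p.1 : ℍ[ℝ]) - p.2 • I)‖ ^ 2 *
            Real.exp (-(p.1 ^ 2 + p.2 ^ 2)) =
        Real.pi * Nat.factorial n * Nat.factorial m) := by
  constructor
  · intro n m k l hne
    refine integral_slicedMeasure_eq_zero (F := fun q => Real.exp (-‖q‖ ^ 2) •
      (star (qHermite n m q) * qHermite k l q)) ?_ fun I hI => ?_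
    · have := continuous_qHermite n m
      have := continuous_qHermite k l
      fun_prop
    · have hab : 2 * Real.pi = 0 + 2 * Real.pi := (zero_add _).symm
      simp_rw [weighted_qHermite_sliceHom]
      refine (ContinuousLinearMap.integral_comp_comm (sliceHom hI).toLinearMap.toContinuousLinearMap
        (integrable_star_cHermite_mul_cHermite hab n m k l)).trans ?_
      rw [integral_star_cHermite_mul_cHermite hab, if_neg hne, map_zero]
  · intro I hI n m
    have hslice (p : ℝ × ℝ) :
        ‖qHermite2 n m ((p.1 : ℍ[ℝ]) + p.2 • I) ((p.1 : ℍ[ℝ]) - p.2 • I)‖ ^ 2 *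
          Real.exp (-(p.1 ^ 2 + p.2 ^ 2)) =
        (Real.exp (-‖(⟨p.1, p.2⟩ : ℂ)‖ ^ 2) •
          (star (cHermite n m ⟨p.1, p.2⟩ (star ⟨p.1, p.2⟩)) *
            cHermite n m ⟨p.1, p.2⟩ (star ⟨p.1, p.2⟩))).re := by
      have h₁ : (p.1 : ℍ[ℝ]) + p.2 • I = sliceHom hI ⟨p.1, p.2⟩ := by rw [sliceHom_apply]
      have h₂ : (p.1 : ℍ[ℝ]) - p.2 • I = sliceHom hI (star ⟨p.1, p.2⟩) := by
        rw [sliceHom_apply]; simp [sub_eq_add_neg]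
      rw [h₁, h₂, qHermite2_sliceHom, norm_sliceHom_sq, mul_comm (star (cHermite n m _ _)),
        Complex.star_def, Complex.mul_conj, Complex.normSq_eq_norm_sq, Complex.sq_norm ⟨p.1, p.2⟩,
        Complex.normSq_mk, Complex.smul_re, Complex.ofReal_re, smul_eq_mul, mul_comm]
      ring_nf
    have hab : Real.pi = -Real.pi + 2 * Real.pi := by ring
    have hint := integrable_star_cHermite_mul_cHermite hab n m n m
    simp_rw [hslice]
    rw [integral_eq_integral_polar]
    refine (Complex.reCLM.integral_comp_comm hint).trans ?_
    rw [integral_star_cHermite_mul_cHermite hab, if_pos rfl]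
    norm_cast
    simp [mul_assoc]
end
end

section
/- Fix I ∈ 𝕊 and let L² denote the right quaternionic Hilbert space of measurable functions f : ℝ² → ℍ with ∫_{ℝ²} |f(x,y)|²·e^{−(x²+y²)} dx dy < ∞, equipped with this weighted L²-norm. Then the right ℍ-linear span of the family {(x,y) ↦ H_{n,m}(x+Iy, x−Iy) : n, m nonnegative integers} is dense in L²; consequently L² is the orthogonal Hilbert sum over m ≥ 0 of the closures of the right ℍ-linear spans of {(x,y) ↦ H_{n,m}(x+Iy, x−Iy) : n ≥ 0} (the slice restrictions of the generalized quaternionic Bargmann spaces of level m). -/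
open MeasureTheory Quaternion

noncomputable section

/-- The measure on the plane with density `exp (-(x² + y²))` with respect to Lebesgue measure. -/
def gaussPlane : Measure (ℝ × ℝ) :=
  volume.withDensity fun p ↦ ENNReal.ofReal (Real.exp (-(p.1 ^ 2 + p.2 ^ 2)))

lemma integral_gaussPlane {E : Type*} [NormedAddCommGroup E] [NormedSpace ℝ E]
    (f : ℝ × ℝ → E) :
    ∫ p, f p ∂gaussPlane = ∫ p : ℝ × ℝ, Real.exp (-(p.1 ^ 2 + p.2 ^ 2)) • f p := by
  rw [gaussPlane, integral_withDensity_eq_integral_toReal_smul (by fun_prop) (by simp)]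
  simp [ENNReal.toReal_ofReal, Real.exp_nonneg]

lemma integrable_gaussPlane_iff {E : Type*} [NormedAddCommGroup E] [NormedSpace ℝ E]
    {f : ℝ × ℝ → E} :
    Integrable f gaussPlane ↔
      Integrable fun p : ℝ × ℝ ↦ Real.exp (-(p.1 ^ 2 + p.2 ^ 2)) • f p := by
  rw [gaussPlane, integrable_withDensity_iff_integrable_smul' (by fun_prop) (by simp)]
  simp [ENNReal.toReal_ofReal, Real.exp_nonneg]

lemma integrable_exp_neg_half_sq_prod :
    Integrable fun p : ℝ × ℝ ↦ Real.exp (-((p.1 ^ 2 + p.2 ^ 2) / 2)) := by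
  have h := integrable_exp_neg_mul_sq (b := 1 / 2) (by norm_num)
  refine (h.mul_prod h).congr (.of_forall fun p ↦ ?_)
  simp only [← Real.exp_add]
  ring_nf

/-- Functions of at most exponential growth are square integrable for the Gaussian weight. -/
lemma memLp_gaussPlane_of_norm_le_exp {E : Type*} [NormedAddCommGroup E]
    {f : ℝ × ℝ → E} (hf : Continuous f) (C a : ℝ)
    (h : ∀ p, ‖f p‖ ≤ C * Real.exp (a * (|p.1| + |p.2|))) : MemLp f 2 gaussPlane := by
  have hm : AEStronglyMeasurable f gaussPlane := hf.aestronglyMeasurable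
  rw [memLp_two_iff_integrable_sq_norm hm, integrable_gaussPlane_iff]
  refine Integrable.mono' (integrable_exp_neg_half_sq_prod.const_mul
    (C ^ 2 * Real.exp (4 * a ^ 2))) (by fun_prop) (.of_forall fun p ↦ ?_)
  have h1 : ‖f p‖ ^ 2 ≤ C ^ 2 * Real.exp (2 * (a * (|p.1| + |p.2|))) := by
    calc ‖f p‖ ^ 2 ≤ (C * Real.exp (a * (|p.1| + |p.2|))) ^ 2 := by gcongr; exact h p
      _ = _ := by rw [mul_pow, ← Real.exp_nat_mul]; norm_num
  have h2 : Real.exp (2 * (a * (|p.1| + |p.2|))) * Real.exp (-(p.1 ^ 2 + p.2 ^ 2)) ≤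
      Real.exp (4 * a ^ 2) * Real.exp (-((p.1 ^ 2 + p.2 ^ 2) / 2)) := by
    rw [← Real.exp_add, ← Real.exp_add, Real.exp_le_exp]
    nlinarith [sq_nonneg (2 * a - |p.1|), sq_nonneg (2 * a - |p.2|), sq_abs p.1, sq_abs p.2]
  rw [Real.norm_of_nonneg (by positivity), smul_eq_mul]
  calc _ ≤ Real.exp (-(p.1 ^ 2 + p.2 ^ 2)) *
        (C ^ 2 * Real.exp (2 * (a * (|p.1| + |p.2|)))) := by gcongr
    _ = C ^ 2 * (Real.exp (2 * (a * (|p.1| + |p.2|))) * Real.exp (-(p.1 ^ 2 + p.2 ^ 2))) := by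
      ring
    _ ≤ C ^ 2 * (Real.exp (4 * a ^ 2) * Real.exp (-((p.1 ^ 2 + p.2 ^ 2) / 2))) := by gcongr
    _ = _ := by ring

/-- Functions of polynomial growth are square integrable for the Gaussian weight. -/
lemma memLp_gaussPlane_of_norm_le_pow {E : Type*} [NormedAddCommGroup E]
    {f : ℝ × ℝ → E} (hf : Continuous f) (C : ℝ) (k : ℕ)
    (h : ∀ p, ‖f p‖ ≤ C * (|p.1| + |p.2|) ^ k) : MemLp f 2 gaussPlane := by
  refine memLp_gaussPlane_of_norm_le_exp hf (|C| * k.factorial) 1 fun p ↦ ?_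
  have hk : (0 : ℝ) < k.factorial := by positivity
  have := Real.pow_div_factorial_le_exp (|p.1| + |p.2|) (by positivity) k
  rw [div_le_iff₀' hk] at this
  calc _ ≤ _ := h p
    _ ≤ |C| * (|p.1| + |p.2|) ^ k := by gcongr; exact le_abs_self C
    _ ≤ |C| * (k.factorial * Real.exp (|p.1| + |p.2|)) := by gcongr
    _ = _ := by rw [one_mul, mul_assoc]

instance : IsFiniteMeasure gaussPlane := by
  have h : MemLp (fun _ : ℝ × ℝ ↦ (1 : ℝ)) 2 gaussPlane :=
    memLp_gaussPlane_of_norm_le_pow continuous_const 1 0 (by simp)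
  rw [memLp_two_iff_integrable_sq (by fun_prop)] at h
  simpa [integrable_const_iff] using h

lemma integrable_monomial_gaussPlane (a b : ℕ) :
    Integrable (fun p : ℝ × ℝ ↦ (⟨p.1, p.2⟩ : ℂ) ^ a * (⟨p.1, -p.2⟩ : ℂ) ^ b) gaussPlane := by
  have hc : Continuous fun p : ℝ × ℝ ↦ (⟨p.1, p.2⟩ : ℂ) ^ a * (⟨p.1, -p.2⟩ : ℂ) ^ b := by
    simp only [Complex.mk_eq_add_mul_I]
    fun_prop
  refine (memLp_gaussPlane_of_norm_le_pow hc 1 (a + b) fun p ↦ ?_).integrable (by norm_num)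
  rw [norm_mul, norm_pow, norm_pow, one_mul, pow_add]
  gcongr
  · exact Complex.norm_le_abs_re_add_abs_im _
  · simpa using Complex.norm_le_abs_re_add_abs_im ⟨p.1, -p.2⟩

lemma integral_monomial_mul_exp_neg_norm_sq_complex (a b : ℕ) :
    ∫ z : ℂ, z ^ a * (starRingEnd ℂ z) ^ b * Real.exp (-‖z‖ ^ 2) =
      if a = b then (Real.pi * a.factorial : ℂ) else 0 := by
  split_ifs with hab
  · subst hab
    have h := Complex.integral_rpow_mul_exp_neg_rpow (p := 2) (q := 2 * a) (by norm_num)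
      (by linarith [(Nat.cast_nonneg a : (0 : ℝ) ≤ a)])
    have h2 : ((2 : ℝ) * a + 2) / 2 = a + 1 := by ring
    rw [h2, Real.Gamma_nat_eq_factorial] at h
    have h3 : (2 * Real.pi / 2 * a.factorial : ℝ) = Real.pi * a.factorial := by ring
    rw [h3] at h
    have h4 := congrArg (fun x : ℝ ↦ (x : ℂ)) h
    rw [← integral_complex_ofReal] at h4
    push_cast at h4
    rw [← h4]
    congr 1 with z
    rw [← mul_pow, Complex.mul_conj, Complex.normSq_eq_norm_sq]
    have : ‖z‖ ^ (2 * (a : ℝ)) = (‖z‖ ^ 2) ^ a := by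
      rw [← pow_mul, ← Real.rpow_natCast]; norm_num
    rw [this]
    norm_num
  · set M := ∫ z : ℂ, z ^ a * (starRingEnd ℂ z) ^ b * Real.exp (-‖z‖ ^ 2) with hM
    have key (c : Circle) : (c : ℂ) ^ a * (starRingEnd ℂ (c : ℂ)) ^ b * M = M := by
      conv_rhs => rw [hM, ← (rotation c).measurePreserving.integral_comp
        (rotation c).toHomeomorph.measurableEmbedding]
      rw [hM, ← integral_const_mul]
      congr 1 with z
      simp only [rotation_apply, map_mul, norm_mul, Circle.norm_coe, one_mul]
      ring
    by_contra hne
    have key2 (t : ℝ) : Complex.exp (((a : ℝ) - b : ℝ) * t * Complex.I) = 1 := by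
      have h := mul_eq_right₀ hne |>.1 (key (Circle.exp t))
      rw [Circle.coe_exp, ← Complex.exp_conj, ← Complex.exp_nat_mul, ← Complex.exp_nat_mul,
        ← Complex.exp_add] at h
      rw [← h]
      congr 1
      simp
      ring
    have hab' : (a : ℝ) - b ≠ 0 := by
      rw [sub_ne_zero]; exact_mod_cast hab
    have h := key2 (Real.pi / ((a : ℝ) - b))
    rw [← Complex.ofReal_mul, mul_div_cancel₀ _ hab', Complex.exp_pi_mul_I] at h
    norm_num at h

lemma integral_monomial_gaussPlane (a b : ℕ) :
    ∫ p : ℝ × ℝ, (⟨p.1, p.2⟩ : ℂ) ^ a * (⟨p.1, -p.2⟩ : ℂ) ^ b ∂gaussPlane =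
      if a = b then (Real.pi * a.factorial : ℂ) else 0 := by
  rw [integral_gaussPlane, ← integral_monomial_mul_exp_neg_norm_sq_complex,
    ← Complex.volume_preserving_equiv_real_prod.symm.integral_comp
      Complex.measurableEquivRealProd.symm.measurableEmbedding]
  congr 1 with p
  have h1 : Complex.measurableEquivRealProd.symm p = ⟨p.1, p.2⟩ := rfl
  have h2 : ‖(⟨p.1, p.2⟩ : ℂ)‖ ^ 2 = p.1 ^ 2 + p.2 ^ 2 := by
    rw [← Complex.normSq_eq_norm_sq, Complex.normSq_mk]; ring
  rw [h1, h2, Complex.real_smul, mul_comm]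
  rfl

/-- The complex Hermite polynomial `H_{m,n}(z,w)` with binomial coefficients. -/
def complexHermite (m n : ℕ) (z w : ℂ) : ℂ :=
  ∑ j ∈ Finset.range (n + 1),
    (-1) ^ j * (j.factorial * m.choose j * n.choose j) * (z ^ (m - j) * w ^ (n - j))

lemma complexHermite_zero_left (n : ℕ) (z w : ℂ) : complexHermite 0 n z w = w ^ n := by
  rw [complexHermite, Finset.sum_range_succ']
  simp

lemma complexHermite_succ_zero (m : ℕ) (z w : ℂ) :
    complexHermite (m + 1) 0 z w = z * complexHermite m 0 z w := by
  simp [complexHermite, pow_succ']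

lemma complexHermite_succ_succ (m n : ℕ) (z w : ℂ) :
    complexHermite (m + 1) (n + 1) z w =
      z * complexHermite m (n + 1) z w - (n + 1) * complexHermite m n z w := by
  unfold complexHermite
  rw [Finset.sum_range_succ', Finset.sum_range_succ' _ (n + 1), mul_add, Finset.mul_sum,
    Finset.mul_sum, add_sub_right_comm, ← Finset.sum_sub_distrib]
  congr 1
  · refine Finset.sum_congr rfl fun j _ ↦ ?_
    have h1 : ((n + 1).choose (j + 1) : ℂ) * (j + 1) = (n + 1) * n.choose j := by
      exact_mod_cast (Nat.add_one_mul_choose_eq n j).symm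
    have h2 : ((m + 1).choose (j + 1) : ℂ) = m.choose j + m.choose (j + 1) := by
      exact_mod_cast Nat.choose_succ_succ m j
    have h3 : (m.choose (j + 1) : ℂ) * z ^ (m - j) =
        m.choose (j + 1) * (z * z ^ (m - (j + 1))) := by
      rcases Nat.lt_or_ge j m with h | h
      · rw [← pow_succ', show m - (j + 1) + 1 = m - j by omega]
      · simp [Nat.choose_eq_zero_of_lt (show m < j + 1 by omega)]
    rw [h2, Nat.factorial_succ, Nat.add_sub_add_right, Nat.add_sub_add_right]
    push_cast
    linear_combination (-1 : ℂ) ^ (j + 1) * (j + 1) * j.factorial * (n + 1).choose (j + 1) *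
      w ^ (n - j) * h3 + (-1 : ℂ) ^ (j + 1) * j.factorial * m.choose j * z ^ (m - j) *
      w ^ (n - j) * h1
  · simp [pow_succ']
    ring

lemma integrable_complexHermite_mul (m n a b : ℕ) :
    Integrable (fun p : ℝ × ℝ ↦ complexHermite m n ⟨p.1, p.2⟩ ⟨p.1, -p.2⟩ *
      ((⟨p.1, p.2⟩ : ℂ) ^ a * (⟨p.1, -p.2⟩ : ℂ) ^ b)) gaussPlane := by
  simp only [complexHermite, Finset.sum_mul]
  refine integrable_finsetSum _ fun j _ ↦ ?_
  refine ((integrable_monomial_gaussPlane (m - j + a) (n - j + b)).const_mul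
    ((-1) ^ j * (j.factorial * m.choose j * n.choose j))).congr (.of_forall fun p ↦ ?_)
  simp only [pow_add]
  ring

lemma integral_complexHermite_mul (m n a b : ℕ) :
    ∫ p : ℝ × ℝ, complexHermite m n ⟨p.1, p.2⟩ ⟨p.1, -p.2⟩ *
      ((⟨p.1, p.2⟩ : ℂ) ^ a * (⟨p.1, -p.2⟩ : ℂ) ^ b) ∂gaussPlane =
      if a + m = b + n then
        (Real.pi * (b.descFactorial m * a.descFactorial n * (a - n).factorial : ℕ) : ℂ)
      else 0 := by
  induction m generalizing n a b with
  | zero =>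
    have h (p : ℝ × ℝ) : complexHermite 0 n ⟨p.1, p.2⟩ ⟨p.1, -p.2⟩ *
        ((⟨p.1, p.2⟩ : ℂ) ^ a * (⟨p.1, -p.2⟩ : ℂ) ^ b) =
        (⟨p.1, p.2⟩ : ℂ) ^ a * (⟨p.1, -p.2⟩ : ℂ) ^ (b + n) := by
      rw [complexHermite_zero_left]; ring
    simp only [h, integral_monomial_gaussPlane, add_zero]
    split_ifs with hab
    · rw [Nat.descFactorial_zero, one_mul, mul_comm (a.descFactorial n),
        Nat.factorial_mul_descFactorial (by omega)]
    · rfl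
  | succ m ih =>
    cases n with
    | zero =>
      have h (p : ℝ × ℝ) : complexHermite (m + 1) 0 ⟨p.1, p.2⟩ ⟨p.1, -p.2⟩ *
          ((⟨p.1, p.2⟩ : ℂ) ^ a * (⟨p.1, -p.2⟩ : ℂ) ^ b) =
          complexHermite m 0 ⟨p.1, p.2⟩ ⟨p.1, -p.2⟩ *
          ((⟨p.1, p.2⟩ : ℂ) ^ (a + 1) * (⟨p.1, -p.2⟩ : ℂ) ^ b) := by
        rw [complexHermite_succ_zero]; ring
      simp only [h, ih]
      by_cases hab : a + 1 + m = b + 0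
      · rw [if_pos hab, if_pos (by omega)]
        congr 2
        rw [Nat.descFactorial_succ, show b - m = a + 1 by omega]
        simp [Nat.factorial_succ]
        ring
      · rw [if_neg hab, if_neg (by omega)]
    | succ n =>
      have h (p : ℝ × ℝ) : complexHermite (m + 1) (n + 1) ⟨p.1, p.2⟩ ⟨p.1, -p.2⟩ *
          ((⟨p.1, p.2⟩ : ℂ) ^ a * (⟨p.1, -p.2⟩ : ℂ) ^ b) =
          complexHermite m (n + 1) ⟨p.1, p.2⟩ ⟨p.1, -p.2⟩ *
            ((⟨p.1, p.2⟩ : ℂ) ^ (a + 1) * (⟨p.1, -p.2⟩ : ℂ) ^ b) -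
          (n + 1) * (complexHermite m n ⟨p.1, p.2⟩ ⟨p.1, -p.2⟩ *
            ((⟨p.1, p.2⟩ : ℂ) ^ a * (⟨p.1, -p.2⟩ : ℂ) ^ b)) := by
        rw [complexHermite_succ_succ]; ring
      simp only [h]
      rw [integral_sub (integrable_complexHermite_mul ..)
        ((integrable_complexHermite_mul ..).const_mul _), integral_const_mul, ih, ih]
      by_cases hab : a + m = b + n
      · rw [if_pos (by omega), if_pos hab, if_pos (by omega)]
        rcases Nat.lt_or_ge b m with hb | hb
        · simp [Nat.descFactorial_of_lt hb]
        · obtain ⟨d, rfl⟩ := Nat.exists_eq_add_of_le hb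
          obtain rfl : a = n + d := by omega
          rw [Nat.succ_descFactorial_succ, Nat.descFactorial_succ, Nat.descFactorial_succ,
            show n + d + 1 - (n + 1) = d by omega, show n + d - n = d by omega,
            show m + d - m = d by omega]
          cases d with
          | zero => simp; ring
          | succ d =>
            rw [show n + (d + 1) - (n + 1) = d by omega, Nat.factorial_succ]
            push_cast
            ring
      · rw [if_neg (by omega), if_neg hab, if_neg (by omega)]
        simp

lemma integral_complexHermite_mul_complexHermite_of_lt {m n k l : ℕ} (h : k < n ∨ l < m) :
    ∫ p : ℝ × ℝ, complexHermite m n ⟨p.1, p.2⟩ ⟨p.1, -p.2⟩ *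
      complexHermite k l ⟨p.1, p.2⟩ ⟨p.1, -p.2⟩ ∂gaussPlane = 0 := by
  have hsum (p : ℝ × ℝ) : complexHermite m n ⟨p.1, p.2⟩ ⟨p.1, -p.2⟩ *
      complexHermite k l ⟨p.1, p.2⟩ ⟨p.1, -p.2⟩ = ∑ j ∈ Finset.range (l + 1),
        (-1) ^ j * (j.factorial * k.choose j * l.choose j) *
          (complexHermite m n ⟨p.1, p.2⟩ ⟨p.1, -p.2⟩ *
          ((⟨p.1, p.2⟩ : ℂ) ^ (k - j) * (⟨p.1, -p.2⟩ : ℂ) ^ (l - j))) := by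
    conv_lhs => rw [complexHermite.eq_1 k l, Finset.mul_sum]
    exact Finset.sum_congr rfl fun j _ ↦ by ring
  simp only [hsum]
  rw [integral_finsetSum _ fun j _ ↦ (integrable_complexHermite_mul ..).const_mul _]
  refine Finset.sum_eq_zero fun j _ ↦ ?_
  rw [integral_const_mul, integral_complexHermite_mul]
  rcases h with h | h
  · simp [Nat.descFactorial_of_lt (show k - j < n by omega)]
  · simp [Nat.descFactorial_of_lt (show l - j < m by omega)]

lemma integral_complexHermite_mul_complexHermite {m n k l : ℕ} (h : (n, m) ≠ (k, l)) :
    ∫ p : ℝ × ℝ, complexHermite m n ⟨p.1, p.2⟩ ⟨p.1, -p.2⟩ *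
      complexHermite k l ⟨p.1, p.2⟩ ⟨p.1, -p.2⟩ ∂gaussPlane = 0 := by
  rw [Ne, Prod.mk.injEq, not_and_or] at h
  by_cases h' : k < n ∨ l < m
  · exact integral_complexHermite_mul_complexHermite_of_lt h'
  · simp only [mul_comm (complexHermite m n _ _)]
    exact integral_complexHermite_mul_complexHermite_of_lt (by omega)

lemma complexHermite_comm (m n : ℕ) (z w : ℂ) :
    complexHermite m n z w = complexHermite n m w z := by
  wlog h : m ≤ n generalizing m n z w
  · exact (this n m w z (le_of_not_ge h)).symm
  unfold complexHermite
  rw [← Finset.sum_subset (Finset.range_mono (Nat.succ_le_succ h))]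
  · exact Finset.sum_congr rfl fun j _ ↦ by ring
  · intro j _ hj
    rw [Finset.mem_range] at hj
    simp [Nat.choose_eq_zero_of_lt (show m < j by omega)]

section Slice

variable (I : ℍ[ℝ])

lemma liftAux_mk (hI : I * I = -1) (x y : ℝ) : Complex.liftAux I hI ⟨x, y⟩ = (x : ℍ[ℝ]) + y • I :=
  Complex.liftAux_apply I hI _

lemma liftAux_mk_neg (hI : I * I = -1) (x y : ℝ) : Complex.liftAux I hI ⟨x, -y⟩ = (x : ℍ[ℝ]) - y • I := by
  rw [liftAux_mk, neg_smul, sub_eq_add_neg]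

lemma qHermite2_slice (hI : I * I = -1) (m n : ℕ) (x y : ℝ) :
    qHermite2 m n ((x : ℍ[ℝ]) + y • I) ((x : ℍ[ℝ]) - y • I) =
      Complex.liftAux I hI (complexHermite m n ⟨x, y⟩ ⟨x, -y⟩) := by
  wlog h : n ≤ m generalizing m n y
  · have h' := this n m (-y) (le_of_not_ge h)
    rw [neg_neg, ← complexHermite_comm, neg_smul, ← sub_eq_add_neg, sub_neg_eq_add] at h'
    rw [← h']
    unfold qHermite2
    rw [min_comm]
    refine Finset.sum_congr rfl fun j _ ↦ ?_
    rw [← liftAux_mk I hI, ← liftAux_mk_neg I hI, ← map_pow, ← map_pow, ← map_mul, ← map_mul,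
      mul_comm (_ ^ (m - j)), mul_comm (m.factorial : ℝ),
      mul_comm ((m - j).factorial : ℝ)]
  rw [qHermite2, complexHermite, map_sum, min_eq_right h]
  refine Finset.sum_congr rfl fun j hj ↦ ?_
  have hjn : j ≤ n := Nat.lt_succ_iff.1 (Finset.mem_range.1 hj)
  rw [← liftAux_mk I hI, ← liftAux_mk_neg I hI, ← map_pow, ← map_pow, ← map_mul, ← map_smul,
    Complex.real_smul]
  congr 2
  rw [Nat.cast_choose ℂ hjn, Nat.cast_choose ℂ (hjn.trans h)]
  have h1 (k : ℕ) : (k.factorial : ℂ) ≠ 0 := by exact_mod_cast k.factorial_ne_zero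
  have := h1 j
  have := h1 (m - j)
  have := h1 (n - j)
  push_cast
  field_simp

lemma star_eq_neg_of_mul_self (hI : I * I = -1) : star I = -I := by
  have hne : I ≠ 0 := by rintro rfl; simp at hI
  have hn : ‖I‖ = 1 := by
    have h := congrArg norm hI
    rw [norm_mul, norm_neg, norm_one] at h
    nlinarith [norm_nonneg I]
  have h : star I * I = 1 := by
    rw [Quaternion.star_mul_self, Quaternion.normSq_eq_norm_mul_self, hn]; simp
  exact mul_right_cancel₀ hne (by rw [h, neg_mul, hI, neg_neg])

lemma star_liftAux (hI : I * I = -1) (z : ℂ) :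
    star (Complex.liftAux I hI z) = Complex.liftAux I hI (starRingEnd ℂ z) := by
  obtain ⟨x, y⟩ := z
  rw [liftAux_mk, star_add, Quaternion.star_smul, star_eq_neg_of_mul_self I hI,
    Quaternion.star_coe, smul_neg, ← sub_eq_add_neg, ← liftAux_mk_neg I hI]
  rfl

lemma conj_complexHermite (m n : ℕ) (x y : ℝ) :
    starRingEnd ℂ (complexHermite m n ⟨x, y⟩ ⟨x, -y⟩) = complexHermite n m ⟨x, y⟩ ⟨x, -y⟩ := by
  have h1 : starRingEnd ℂ ⟨x, y⟩ = ⟨x, -y⟩ := rfl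
  have h2 : starRingEnd ℂ ⟨x, -y⟩ = ⟨x, y⟩ := by rw [← h1, Complex.conj_conj]
  rw [complexHermite_comm n m]
  simp [complexHermite, h1, h2]

/-- Slice Hermite polynomials with distinct indices are orthogonal for the Gaussian weight. -/
lemma integral_star_qHermite2_mul_qHermite2 (hI : I * I = -1) {n m k l : ℕ} (h : (n, m) ≠ (k, l)) :
    ∫ p : ℝ × ℝ, star (qHermite2 n m ((p.1 : ℍ[ℝ]) + p.2 • I) ((p.1 : ℍ[ℝ]) - p.2 • I)) *
      qHermite2 k l ((p.1 : ℍ[ℝ]) + p.2 • I) ((p.1 : ℍ[ℝ]) - p.2 • I) ∂gaussPlane = 0 := by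
  simp only [qHermite2_slice I hI, star_liftAux, conj_complexHermite, ← map_mul]
  have hint : Integrable (fun p : ℝ × ℝ ↦ complexHermite m n ⟨p.1, p.2⟩ ⟨p.1, -p.2⟩ *
      complexHermite k l ⟨p.1, p.2⟩ ⟨p.1, -p.2⟩) gaussPlane := by
    simp only [complexHermite.eq_1 k l, Finset.mul_sum]
    refine integrable_finsetSum _ fun j _ ↦ ?_
    refine ((integrable_complexHermite_mul m n (k - j) (l - j)).const_mul
      ((-1) ^ j * (j.factorial * k.choose j * l.choose j))).congr (.of_forall fun p ↦ ?_)
    simp only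
    ring
  have hcomm := (Complex.liftAux I hI).toLinearMap.toContinuousLinearMap.integral_comp_comm hint
  rw [integral_complexHermite_mul_complexHermite h, map_zero] at hcomm
  exact hcomm

/-- The right `ℍ`-linear span of the Hermite polynomials restricted to the slice of `I`. -/
def sliceHermiteSpan : Submodule ℍ[ℝ]ᵐᵒᵖ (ℝ × ℝ → ℍ[ℝ]) :=
  Submodule.span _ (Set.range fun (nm : ℕ × ℕ) (p : ℝ × ℝ) ↦
    qHermite2 nm.1 nm.2 ((p.1 : ℍ[ℝ]) + p.2 • I) ((p.1 : ℍ[ℝ]) - p.2 • I))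

lemma exists_sum_of_mem_sliceHermiteSpan {w : ℝ × ℝ → ℍ[ℝ]} (hw : w ∈ sliceHermiteSpan I) :
    ∃ (s : Finset (ℕ × ℕ)) (c : ℕ × ℕ → ℍ[ℝ]), ∀ p, w p = ∑ nm ∈ s,
      qHermite2 nm.1 nm.2 ((p.1 : ℍ[ℝ]) + p.2 • I) ((p.1 : ℍ[ℝ]) - p.2 • I) * c nm := by
  rw [sliceHermiteSpan, Finsupp.mem_span_range_iff_exists_finsupp] at hw
  obtain ⟨c, rfl⟩ := hw
  refine ⟨c.support, fun nm ↦ (c nm).unop, fun p ↦ ?_⟩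
  simp [Finsupp.sum, Finset.sum_apply]

lemma mul_mem_sliceHermiteSpan {w : ℝ × ℝ → ℍ[ℝ]} (hw : w ∈ sliceHermiteSpan I) (c : ℍ[ℝ]) :
    (fun p ↦ w p * c) ∈ sliceHermiteSpan I :=
  (sliceHermiteSpan I).smul_mem (MulOpposite.op c) hw

lemma monomial_mem_sliceHermiteSpan (hI : I * I = -1) (m n : ℕ) :
    (fun p : ℝ × ℝ ↦ Complex.liftAux I hI ((⟨p.1, p.2⟩ : ℂ) ^ m * (⟨p.1, -p.2⟩ : ℂ) ^ n)) ∈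
      sliceHermiteSpan I := by
  induction n using Nat.strong_induction_on generalizing m with
  | _ n ih =>
    have hH : (fun p : ℝ × ℝ ↦ Complex.liftAux I hI (complexHermite m n ⟨p.1, p.2⟩ ⟨p.1, -p.2⟩)) ∈
        sliceHermiteSpan I := by
      simp only [← qHermite2_slice]
      exact Submodule.subset_span ⟨(m, n), rfl⟩
    have hsum := Submodule.sum_mem (sliceHermiteSpan I) (t := Finset.range n) fun j hj ↦
      mul_mem_sliceHermiteSpan I (ih (n - (j + 1)) (by have := Finset.mem_range.1 hj; omega)
        (m - (j + 1))) (Complex.liftAux I hI ((-1) ^ (j + 1) *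
          ((j + 1).factorial * m.choose (j + 1) * n.choose (j + 1))))
    convert sub_mem hH hsum using 1
    funext p
    simp only [Pi.sub_apply, Finset.sum_apply, ← map_mul, ← map_sum, ← map_sub]
    congr 1
    rw [complexHermite, Finset.sum_range_succ', add_sub_right_comm, ← Finset.sum_sub_distrib,
      Finset.sum_eq_zero fun j _ ↦ by ring]
    simp

lemma linear_pow_mul_mem_sliceHermiteSpan (hI : I * I = -1) (s t : ℝ) (n : ℕ) (c : ℍ[ℝ]) :
    (fun p : ℝ × ℝ ↦ (s * p.1 + t * p.2) ^ n • c) ∈ sliceHermiteSpan I := by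
  have hsum := Submodule.sum_mem (sliceHermiteSpan I) (t := Finset.range (n + 1)) fun k _ ↦
    mul_mem_sliceHermiteSpan I (mul_mem_sliceHermiteSpan I
      (monomial_mem_sliceHermiteSpan I hI k (n - k)) (Complex.liftAux I hI
        (((s - t * Complex.I) / 2) ^ k * ((s + t * Complex.I) / 2) ^ (n - k) * n.choose k))) c
  convert hsum using 1
  funext p
  simp only [Finset.sum_apply, ← map_mul, ← Finset.sum_mul, ← map_sum]
  have h : ∑ k ∈ Finset.range (n + 1), (⟨p.1, p.2⟩ : ℂ) ^ k * (⟨p.1, -p.2⟩ : ℂ) ^ (n - k) *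
      (((s - t * Complex.I) / 2) ^ k * ((s + t * Complex.I) / 2) ^ (n - k) * n.choose k) =
      ((s * p.1 + t * p.2) ^ n : ℝ) := by
    have h1 : ((s * p.1 + t * p.2 : ℝ) : ℂ) = (s - t * Complex.I) / 2 * ⟨p.1, p.2⟩ +
        (s + t * Complex.I) / 2 * ⟨p.1, -p.2⟩ := by
      rw [Complex.mk_eq_add_mul_I, Complex.mk_eq_add_mul_I]
      push_cast
      linear_combination (t * p.2 : ℂ) * Complex.I_mul_I
    rw [Complex.ofReal_pow, h1, add_pow]
    refine Finset.sum_congr rfl fun k _ ↦ ?_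
    rw [mul_pow, mul_pow]
    ring
  rw [h, ← Complex.coe_algebraMap, AlgHom.commutes, Algebra.smul_def]

lemma memLp_of_mem_sliceHermiteSpan {w : ℝ × ℝ → ℍ[ℝ]} (hw : w ∈ sliceHermiteSpan I) :
    MemLp w 2 gaussPlane := by
  have hmono (m n : ℕ) (c : ℝ) : MemLp (fun p : ℝ × ℝ ↦
      c • (((p.1 : ℍ[ℝ]) + p.2 • I) ^ m * ((p.1 : ℍ[ℝ]) - p.2 • I) ^ n)) 2 gaussPlane := by
    have hx : Continuous fun p : ℝ × ℝ ↦ (p.1 : ℍ[ℝ]) :=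
      Quaternion.continuous_coe.comp continuous_fst
    refine memLp_gaussPlane_of_norm_le_pow (by fun_prop)
      (‖c‖ * ((1 + ‖I‖) ^ m * (1 + ‖I‖) ^ n)) (m + n) fun p ↦ ?_
    have hbound : |p.1| + |p.2| * ‖I‖ ≤ (1 + ‖I‖) * (|p.1| + |p.2|) := by
      nlinarith [norm_nonneg I, abs_nonneg p.1, abs_nonneg p.2,
        mul_nonneg (norm_nonneg I) (abs_nonneg p.1)]
    have hn : ‖(p.1 : ℍ[ℝ])‖ + ‖p.2 • I‖ = |p.1| + |p.2| * ‖I‖ := by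
      rw [norm_smul, Quaternion.norm_coe]; rfl
    have hplus := (norm_add_le (p.1 : ℍ[ℝ]) (p.2 • I)).trans (hn.le.trans hbound)
    have hminus := (norm_sub_le (p.1 : ℍ[ℝ]) (p.2 • I)).trans (hn.le.trans hbound)
    rw [norm_smul, norm_mul, norm_pow, norm_pow]
    calc _ ≤ ‖c‖ * (((1 + ‖I‖) * (|p.1| + |p.2|)) ^ m * ((1 + ‖I‖) * (|p.1| + |p.2|)) ^ n) := by
          gcongr
      _ = _ := by rw [mul_pow, mul_pow, pow_add]; ring
  induction hw using Submodule.span_induction with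
  | mem w hw =>
    obtain ⟨nm, rfl⟩ := hw
    simp only [qHermite2]
    exact memLp_finsetSum _ fun j _ ↦ hmono _ _ _
  | zero => exact MemLp.zero
  | add v w _ _ hv hw => exact hv.add hw
  | smul c w _ hw =>
    refine hw.of_le_mul (c := ‖c.unop‖) ?_ (.of_forall fun p ↦ ?_)
    · exact (continuous_id.mul continuous_const).comp_aestronglyMeasurable
        hw.aestronglyMeasurable
    · rw [Pi.smul_apply, MulOpposite.smul_eq_mul_unop, norm_mul, mul_comm]

end Slice

/-- An integrable function whose Fourier transform vanishes is zero almost everywhere. -/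
lemma ae_eq_zero_of_forall_integral_exp_mul_eq_zero {E : Type*} [NormedAddCommGroup E]
    [NormedSpace ℝ E] [CompleteSpace E] [SecondCountableTopology E] [MeasurableSpace E]
    [BorelSpace E] {μ : Measure E} {g : E → ℝ} (hg : Integrable g μ)
    (h : ∀ L : StrongDual ℝ E, ∫ x, Complex.exp (L x * Complex.I) * (g x : ℂ) ∂μ = 0) :
    g =ᵐ[μ] 0 := by
  have hfin {f : E → ℝ} (hf : Integrable f μ) :
      ∫⁻ x, ENNReal.ofReal (f x) ∂μ ≠ ⊤ := hf.lintegral_lt_top.ne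
  have _ := isFiniteMeasure_withDensity (hfin hg)
  have _ := isFiniteMeasure_withDensity (hfin hg.neg)
  have hchar (L : StrongDual ℝ E) {f : E → ℝ} (hf : Integrable f μ) :
      charFunDual (μ.withDensity fun x ↦ ENNReal.ofReal (f x)) L =
        ∫ x, max (f x) 0 • Complex.exp (L x * Complex.I) ∂μ := by
    rw [charFunDual_apply, integral_withDensity_eq_integral_toReal_smul₀
      hf.aemeasurable.ennreal_ofReal (by simp)]
    simp [ENNReal.toReal_ofReal']
  have hint (L : StrongDual ℝ E) {f : E → ℝ} (hf : Integrable f μ) :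
      Integrable (fun x ↦ max (f x) 0 • Complex.exp (L x * Complex.I)) μ := by
    refine hf.pos_part.norm.mono' ?_ (.of_forall fun x ↦ ?_)
    · exact hf.pos_part.aestronglyMeasurable.smul
        (by fun_prop : Continuous fun x ↦ Complex.exp (L x * Complex.I)).aestronglyMeasurable
    · rw [norm_smul, Complex.norm_exp_ofReal_mul_I, mul_one]
  have heq : μ.withDensity (fun x ↦ ENNReal.ofReal (g x)) =
      μ.withDensity (fun x ↦ ENNReal.ofReal ((-g) x)) := by
    refine Measure.ext_of_charFunDual (funext fun L ↦ ?_)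
    rw [hchar L hg, hchar L hg.neg, ← sub_eq_zero, ← integral_sub (hint L hg) (hint L hg.neg),
      ← h L]
    congr 1 with x
    rw [← sub_smul, Pi.neg_apply, max_zero_sub_max_neg_zero_eq_self, Complex.real_smul, mul_comm]
  have hae := (withDensity_eq_iff hg.aemeasurable.ennreal_ofReal
    hg.neg.aemeasurable.ennreal_ofReal (hfin hg)).1 heq
  filter_upwards [hae] with x hx
  have hx' := congrArg ENNReal.toReal hx
  rw [ENNReal.toReal_ofReal', ENNReal.toReal_ofReal', Pi.neg_apply] at hx'
  rw [Pi.zero_apply, ← max_zero_sub_max_neg_zero_eq_self (g x), hx', sub_self]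

/-- A square integrable function all of whose moments vanish is zero almost everywhere. -/
lemma ae_eq_zero_of_forall_integral_linear_pow_mul_eq_zero {g : ℝ × ℝ → ℝ}
    (hg : MemLp g 2 gaussPlane)
    (h : ∀ (s t : ℝ) (n : ℕ), ∫ p, (s * p.1 + t * p.2) ^ n * g p ∂gaussPlane = 0) :
    g =ᵐ[gaussPlane] 0 := by
  refine ae_eq_zero_of_forall_integral_exp_mul_eq_zero (hg.integrable (by norm_num)) fun L ↦ ?_
  set s := L (1, 0)
  set t := L (0, 1)
  have hL (p : ℝ × ℝ) : L p = s * p.1 + t * p.2 := by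
    have hp : p = p.1 • ((1, 0) : ℝ × ℝ) + p.2 • ((0, 1) : ℝ × ℝ) := by ext <;> simp
    conv_lhs => rw [hp, map_add, map_smul, map_smul, smul_eq_mul, smul_eq_mul]
    ring
  have hexp : MemLp (fun p ↦ Real.exp |L p|) 2 gaussPlane := by
    refine memLp_gaussPlane_of_norm_le_exp (by fun_prop) 1 (|s| + |t|) fun p ↦ ?_
    rw [Real.norm_of_nonneg (Real.exp_nonneg _), one_mul, Real.exp_le_exp, hL]
    calc _ ≤ |s| * |p.1| + |t| * |p.2| := by rw [← abs_mul, ← abs_mul]; exact abs_add_le _ _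
      _ ≤ _ := by
        nlinarith [mul_nonneg (abs_nonneg s) (abs_nonneg p.2),
          mul_nonneg (abs_nonneg t) (abs_nonneg p.1)]
  have hsum (p : ℝ × ℝ) : HasSum (fun n : ℕ ↦ |L p| ^ n / n.factorial * ‖g p‖)
      (Real.exp |L p| * ‖g p‖) := by
    rw [Real.exp_eq_exp_ℝ]
    exact (NormedSpace.expSeries_div_hasSum_exp |L p|).mul_right _
  have hmain := hasSum_integral_of_dominated_convergence (μ := gaussPlane)
    (F := fun (n : ℕ) p ↦ (L p * Complex.I) ^ n / (n.factorial : ℂ) * (g p : ℂ))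
    (f := fun p ↦ Complex.exp (L p * Complex.I) * (g p : ℂ))
    (fun (n : ℕ) p ↦ |L p| ^ n / n.factorial * ‖g p‖)
    (fun n ↦ (by fun_prop : Continuous fun p ↦
      (L p * Complex.I) ^ n / (n.factorial : ℂ)).aestronglyMeasurable.mul
        (Complex.continuous_ofReal.comp_aestronglyMeasurable hg.aestronglyMeasurable))
    (fun n ↦ .of_forall fun p ↦ by simp)
    (.of_forall fun p ↦ (hsum p).summable)
    (by
      simp only [(hsum _).tsum_eq]
      exact hexp.integrable_mul hg.norm)
    (.of_forall fun p ↦ by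
      rw [Complex.exp_eq_exp_ℂ]
      exact (NormedSpace.expSeries_div_hasSum_exp (L p * Complex.I)).mul_right _)
  have hzero (n : ℕ) :
      ∫ p, (L p * Complex.I) ^ n / (n.factorial : ℂ) * (g p : ℂ) ∂gaussPlane = 0 := by
    have hn (p : ℝ × ℝ) : (L p * Complex.I) ^ n / (n.factorial : ℂ) * (g p : ℂ) =
        Complex.I ^ n / n.factorial * ((s * p.1 + t * p.2) ^ n * g p : ℝ) := by
      rw [hL, mul_pow]
      push_cast
      ring
    simp only [hn]
    rw [integral_const_mul, integral_complex_ofReal, h]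
    simp
  simp only [hzero] at hmain
  exact hmain.unique hasSum_zero

/-- The classes of slice Hermite combinations in the weighted `L²` space. -/
def sliceHermiteLp (I : ℍ[ℝ]) : Submodule ℝ (Lp ℍ[ℝ] 2 gaussPlane) where
  carrier := {F | ∃ w ∈ sliceHermiteSpan I, F =ᵐ[gaussPlane] w}
  zero_mem' := ⟨0, zero_mem _, Lp.coeFn_zero _ _ _⟩
  add_mem' := by
    rintro F G ⟨v, hv, hF⟩ ⟨w, hw, hG⟩
    exact ⟨v + w, add_mem hv hw, (Lp.coeFn_add F G).trans (hF.add hG)⟩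
  smul_mem' := by
    rintro r F ⟨w, hw, hF⟩
    refine ⟨fun p ↦ w p * (r : ℍ[ℝ]), mul_mem_sliceHermiteSpan I hw r, ?_⟩
    filter_upwards [Lp.coeFn_smul r F, hF] with p h1 h2
    rw [h1, Pi.smul_apply, h2, Quaternion.mul_coe_eq_smul]

lemma sliceHermiteLp_orthogonal (I : ℍ[ℝ]) (hI : I * I = -1) : (sliceHermiteLp I)ᗮ = ⊥ := by
  rw [Submodule.eq_bot_iff]
  intro F hF
  rw [Lp.eq_zero_iff_ae_eq_zero]
  refine ae_eq_zero_of_forall_inner (𝕜 := ℝ) fun c ↦ ?_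
  refine ae_eq_zero_of_forall_integral_linear_pow_mul_eq_zero ((Lp.memLp F).const_inner c)
    fun s t n ↦ ?_
  have hw := linear_pow_mul_mem_sliceHermiteSpan I hI s t n c
  have hLp := memLp_of_mem_sliceHermiteSpan I hw
  have h := (Submodule.mem_orthogonal _ F).1 hF (hLp.toLp _) ⟨_, hw, hLp.coeFn_toLp⟩
  rw [L2.inner_def] at h
  rw [← h]
  refine integral_congr_ae ?_
  filter_upwards [hLp.coeFn_toLp] with p hp
  rw [hp, real_inner_smul_left]

/-- Slice Hermite combinations are dense in the weighted `L²` space. -/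
lemma exists_mem_sliceHermiteSpan_integral_lt (I : ℍ[ℝ]) (hI : I * I = -1)
    {f : ℝ × ℝ → ℍ[ℝ]} (hf : MemLp f 2 gaussPlane) {ε : ℝ} (hε : 0 < ε) :
    ∃ w ∈ sliceHermiteSpan I, ∫ p, ‖f p - w p‖ ^ 2 ∂gaussPlane < ε := by
  have htop := Submodule.topologicalClosure_eq_top_iff.2 (sliceHermiteLp_orthogonal I hI)
  have hmem : hf.toLp f ∈ closure (sliceHermiteLp I : Set (Lp ℍ[ℝ] 2 gaussPlane)) := by
    rw [← Submodule.topologicalClosure_coe, htop]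
    exact Set.mem_univ _
  obtain ⟨G, ⟨w, hw, hG⟩, hdist⟩ := Metric.mem_closure_iff.1 hmem (√ε) (Real.sqrt_pos.2 hε)
  refine ⟨w, hw, ?_⟩
  have hint : ∫ p, ‖f p - w p‖ ^ 2 ∂gaussPlane = ‖hf.toLp f - G‖ ^ 2 := by
    rw [← real_inner_self_eq_norm_sq, L2.inner_def]
    refine integral_congr_ae ?_
    filter_upwards [Lp.coeFn_sub (hf.toLp f) G, hf.coeFn_toLp, hG] with p h1 h2 h3
    rw [real_inner_self_eq_norm_sq, h1, Pi.sub_apply, h2, h3]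
  rw [hint, ← dist_eq_norm, ← Real.sq_sqrt hε.le]
  gcongr

lemma memLp_gaussPlane_of_lintegral_lt_top {E : Type*} [NormedAddCommGroup E]
    [MeasurableSpace E] [BorelSpace E] [SecondCountableTopology E]
    {f : ℝ × ℝ → E} (hf : Measurable f)
    (h : (∫⁻ p : ℝ × ℝ,
      (‖f p‖₊ : ENNReal) ^ 2 * ENNReal.ofReal (Real.exp (-(p.1 ^ 2 + p.2 ^ 2)))) < ⊤) :
    MemLp f 2 gaussPlane := by
  refine ⟨hf.aestronglyMeasurable, ?_⟩
  rw [eLpNorm_lt_top_iff_lintegral_rpow_enorm_lt_top (by norm_num) (by norm_num), gaussPlane,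
    lintegral_withDensity_eq_lintegral_mul _ (by fun_prop) (by fun_prop)]
  refine lt_of_eq_of_lt (lintegral_congr fun p ↦ ?_) h
  simp [mul_comm, enorm_eq_nnnorm]

/-- On a fixed slice, the right `ℍ`-linear span of the quaternionic
Hermite polynomials `H_{n,m}(x+Iy, x−Iy)` is dense in the weighted `L²` space with weight
`e^{−(x²+y²)}`; moreover the polynomials with different indices are orthogonal there, so
`L²` is the orthogonal Hilbert sum over `m` of the (slice restrictions of the) generalized
quaternionic Bargmann spaces of level `m`. -/
theorem stmt19 (I : ℍ[ℝ]) (hI : I ^ 2 = -1) :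
    (∀ f : ℝ × ℝ → ℍ[ℝ], Measurable f →
      (∫⁻ p : ℝ × ℝ,
          (‖f p‖₊ : ENNReal) ^ 2 * ENNReal.ofReal (Real.exp (-(p.1 ^ 2 + p.2 ^ 2)))) < ⊤ →
      ∀ ε : ℝ, 0 < ε →
        ∃ (s : Finset (ℕ × ℕ)) (c : ℕ × ℕ → ℍ[ℝ]),
          (∫ p : ℝ × ℝ,
              ‖f p - ∑ nm ∈ s,
                  qHermite2 nm.1 nm.2 ((p.1 : ℍ[ℝ]) + p.2 • I)
                      ((p.1 : ℍ[ℝ]) - p.2 • I) * c nm‖ ^ 2 *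
                Real.exp (-(p.1 ^ 2 + p.2 ^ 2))) < ε) ∧
    (∀ n m k l : ℕ, (n, m) ≠ (k, l) →
      ∫ p : ℝ × ℝ,
          Real.exp (-(p.1 ^ 2 + p.2 ^ 2)) •
            (star (qHermite2 n m ((p.1 : ℍ[ℝ]) + p.2 • I) ((p.1 : ℍ[ℝ]) - p.2 • I)) *
              qHermite2 k l ((p.1 : ℍ[ℝ]) + p.2 • I) ((p.1 : ℍ[ℝ]) - p.2 • I)) = 0) := by
  have hI' : I * I = -1 := by rw [← sq, hI]
  refine ⟨fun f hf hfin ε hε ↦ ?_, fun n m k l h ↦ ?_⟩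
  · obtain ⟨w, hw, hlt⟩ := exists_mem_sliceHermiteSpan_integral_lt I hI'
      (memLp_gaussPlane_of_lintegral_lt_top hf hfin) hε
    obtain ⟨s, c, hsc⟩ := exists_sum_of_mem_sliceHermiteSpan I hw
    refine ⟨s, c, ?_⟩
    rw [integral_gaussPlane] at hlt
    simpa only [hsc, smul_eq_mul, mul_comm] using hlt
  · rw [← integral_gaussPlane]
    exact integral_star_qHermite2_mul_qHermite2 I hI' h
end
end
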